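/- arXiv:2002.06847 — 5 statements merged into one kernel-verified Lean document; each statement's English description precedes it below -/
import Mathlib

section
/- Let A be a unital locally matrix algebra over a field F and let e ∈ A be an idempotent. Suppose A₁ and A₂ are unital subalgebras of A containing 1_A with e ∈ A₁ and e ∈ A₂, and φ : A₁ ≅ M_n(F), ψ : A₂ ≅ M_m(F) are F-algebra isomorphisms. If r is the rank of the matrix φ(e) and s is the rank of the matrix ψ(e), then r·m = s·n (i.e., the relative rank r(e) = r/n does not depend on the choice of the matrix subalgebra). -/
open Module

/-- The rank of `a * b` agrees with that of `b * a` when both products are idempotent. -/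
theorem finrank_range_mul_comm_of_isIdempotentElem {F W : Type*} [Field F] [AddCommGroup W]
    [Module F W] [FiniteDimensional F W] {a b : End F W}
    (hab : IsIdempotentElem (a * b)) (hba : IsIdempotentElem (b * a)) :
    finrank F (LinearMap.range (a * b)) = finrank F (LinearMap.range (b * a)) := by
  have key : ∀ c d : End F W, IsIdempotentElem (c * d) →
      finrank F (LinearMap.range (c * d)) ≤ finrank F (LinearMap.range (d * c)) := by
    intro c d h
    calc finrank F (LinearMap.range (c * d))
        = finrank F (LinearMap.range (c * (d * c) * d)) := by
          rw [show c * (d * c) * d = c * d by simpa only [mul_assoc] using h.eq]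
      _ ≤ finrank F (LinearMap.range (c * (d * c))) :=
          Submodule.finrank_mono (LinearMap.range_comp_le_range d (c * (d * c)))
      _ ≤ finrank F (LinearMap.range (d * c)) := by
          have : LinearMap.range (c * (d * c)) = (LinearMap.range (d * c)).map c :=
            LinearMap.range_comp (d * c) c
          rw [this]
          exact Submodule.finrank_map_le c _
  exact le_antisymm (key a b hab) (key b a hba)

/-- The rank is additive on orthogonal idempotents. -/
theorem finrank_range_add_of_orthogonal {F W : Type*} [Field F] [AddCommGroup W]
    [Module F W] [FiniteDimensional F W] {p q : End F W}
    (hp : IsIdempotentElem p) (hq : IsIdempotentElem q) (hpq : p * q = 0) (hqp : q * p = 0) :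
    finrank F (LinearMap.range (p + q)) =
      finrank F (LinearMap.range p) + finrank F (LinearMap.range q) := by
  have hp' (x : W) : p (p x) = p x := LinearMap.congr_fun hp.eq x
  have hq' (x : W) : q (q x) = q x := LinearMap.congr_fun hq.eq x
  have hpq' (x : W) : p (q x) = 0 := LinearMap.congr_fun hpq x
  have hqp' (x : W) : q (p x) = 0 := LinearMap.congr_fun hqp x
  have hsup : LinearMap.range (p + q) = LinearMap.range p ⊔ LinearMap.range q := by
    apply le_antisymm
    · rintro _ ⟨x, rfl⟩
      exact Submodule.add_mem_sup ⟨x, rfl⟩ ⟨x, rfl⟩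
    · refine sup_le ?_ ?_
      · rintro _ ⟨x, rfl⟩
        exact ⟨p x, by simp [hp', hqp']⟩
      · rintro _ ⟨x, rfl⟩
        exact ⟨q x, by simp [hq', hpq']⟩
  have hinf : LinearMap.range p ⊓ LinearMap.range q = ⊥ := by
    rw [eq_bot_iff]
    rintro _ ⟨⟨x, rfl⟩, ⟨y, hy⟩⟩
    rw [Submodule.mem_bot, ← hp', ← hy, hpq']
  have h := Submodule.finrank_sup_add_finrank_inf_eq (LinearMap.range p) (LinearMap.range q)
  rw [hinf, finrank_bot, add_zero] at h
  rw [hsup, h]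

theorem finrank_range_sum_of_orthogonalIdempotents {F W ι : Type*} [Field F] [AddCommGroup W]
    [Module F W] [FiniteDimensional F W] {p : ι → End F W}
    (hp : OrthogonalIdempotents p) (s : Finset ι) :
    finrank F (LinearMap.range (∑ i ∈ s, p i)) = ∑ i ∈ s, finrank F (LinearMap.range (p i)) := by
  classical
  induction s using Finset.induction_on with
  | empty => rw [Finset.sum_empty, Finset.sum_empty, LinearMap.range_zero, finrank_bot]
  | insert i s hi ih =>
    rw [Finset.sum_insert hi, Finset.sum_insert hi, ← ih]
    exact finrank_range_add_of_orthogonal (hp.idem i) hp.isIdempotentElem_sum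
      (hp.mul_sum_of_notMem hi)
      (by
        rw [Finset.sum_mul]
        exact Finset.sum_eq_zero fun j hj => hp.ortho (ne_of_mem_of_not_mem hj hi))

/-- An algebra homomorphism between endomorphism algebras multiplies the rank of every
idempotent by the rank of the image of a fixed rank-one idempotent. -/
theorem finrank_range_map_eq_mul {F V W : Type*} [Field F] [AddCommGroup V]
    [Module F V] [FiniteDimensional F V] [AddCommGroup W] [Module F W] [FiniteDimensional F W]
    (f : End F V →ₐ[F] End F W) {v : V} {y : Dual F V} (hyv : y v = 1)
    {e : End F V} (he : IsIdempotentElem e) :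
    finrank F (LinearMap.range (f e)) =
      finrank F (LinearMap.range e) * finrank F (LinearMap.range (f (y.smulRight v))) := by
  classical
  have he' (x : V) : e (e x) = e x := LinearMap.congr_fun he.eq x
  let b := Module.finBasis F (LinearMap.range e)
  let Y : Fin (finrank F (LinearMap.range e)) → Dual F V := fun i => b.coord i ∘ₗ e.rangeRestrict
  let p : Fin (finrank F (LinearMap.range e)) → End F V := fun i => (Y i).smulRight (b i : V)
  have hfix (x : LinearMap.range e) : e.rangeRestrict x = x := by
    obtain ⟨_, x, rfl⟩ := x
    exact Subtype.ext (he' x)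
  have hY (i j) : Y i (b j) = if i = j then 1 else 0 := by
    simp [Y, hfix, Finsupp.single_apply, eq_comm]
  have hp : OrthogonalIdempotents p := by
    refine ⟨fun i => ?_, fun i j hij => ?_⟩
    · ext x
      simp [p, hY]
    · ext x
      simp [p, hY, hij]
  have hsum : ∑ i, p i = e := by
    ext x
    have h := congrArg (LinearMap.range e).subtype (b.sum_repr (e.rangeRestrict x))
    rw [map_sum] at h
    rw [LinearMap.sum_apply]
    exact h
  have hrank (i) : finrank F (LinearMap.range (f (p i))) =
      finrank F (LinearMap.range (f (y.smulRight v))) := by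
    have h₁ : p i = y.smulRight (b i : V) * (Y i).smulRight v := by
      ext x
      simp [p, hyv]
    have h₂ : (y.smulRight v : End F V) = (Y i).smulRight v * y.smulRight (b i : V) := by
      ext x
      simp [hY]
    have hy : IsIdempotentElem (y.smulRight v : End F V) := by
      ext x
      simp [hyv]
    have i₁ := (hp.idem i).map f
    have i₂ := hy.map f
    rw [h₁, map_mul] at i₁ ⊢
    rw [h₂, map_mul] at i₂ ⊢
    exact finrank_range_mul_comm_of_isIdempotentElem i₁ i₂
  have hfp : OrthogonalIdempotents (fun i => f (p i)) := hp.map f.toRingHom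
  have h := finrank_range_sum_of_orthogonalIdempotents hfp Finset.univ
  rw [← map_sum, hsum] at h
  simp [h, hrank]

/-- A unital algebra homomorphism between endomorphism algebras preserves the relative rank of
idempotents. -/
theorem finrank_range_map_mul_finrank {F V W : Type*} [Field F] [AddCommGroup V]
    [Module F V] [FiniteDimensional F V] [Nontrivial V]
    [AddCommGroup W] [Module F W] [FiniteDimensional F W]
    (f : End F V →ₐ[F] End F W) {e : End F V} (he : IsIdempotentElem e) :
    finrank F (LinearMap.range (f e)) * finrank F V =
      finrank F (LinearMap.range e) * finrank F W := by
  obtain ⟨v, hv⟩ := exists_ne (0 : V)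
  obtain ⟨y, hy⟩ := Module.Projective.exists_dual_eq_one F hv
  have h₁ := finrank_range_map_eq_mul f hy (IsIdempotentElem.one (M := End F V))
  rw [map_one, End.one_eq_id, End.one_eq_id, LinearMap.range_id, LinearMap.range_id,
    finrank_top, finrank_top] at h₁
  rw [finrank_range_map_eq_mul f hy he, h₁]
  ring

/-- A unital algebra homomorphism between matrix algebras preserves the relative rank of
idempotents. -/
theorem Matrix.rank_map_mul_of_isIdempotentElem {F : Type*} [Field F] {n k : ℕ} (hn : 1 ≤ n)
    (f : Matrix (Fin n) (Fin n) F →ₐ[F] Matrix (Fin k) (Fin k) F)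
    {e : Matrix (Fin n) (Fin n) F} (he : IsIdempotentElem e) :
    (f e).rank * n = e.rank * k := by
  have : Nonempty (Fin n) := ⟨⟨0, hn⟩⟩
  let g : End F (Fin n → F) →ₐ[F] End F (Fin k → F) :=
    (Matrix.toLinAlgEquiv'.toAlgHom.comp f).comp Matrix.toLinAlgEquiv'.symm.toAlgHom
  have hg : g (Matrix.toLinAlgEquiv' e) = Matrix.toLinAlgEquiv' (f e) := by
    simp [g]
  have h := finrank_range_map_mul_finrank g (he.map Matrix.toLinAlgEquiv')
  rw [hg, finrank_fin_fun, finrank_fin_fun] at h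
  exact h

/-- If a matrix subalgebra `A₁` is contained in a matrix subalgebra `B`, then the relative ranks
of an idempotent of `A₁` computed in `A₁` and in `B` agree. -/
theorem Subalgebra.rank_mul_eq_of_le {F A : Type*} [Field F] [Ring A] [Algebra F A]
    {n k : ℕ} (hn : 1 ≤ n) {A₁ B : Subalgebra F A} (hle : A₁ ≤ B)
    (φ : A₁ ≃ₐ[F] Matrix (Fin n) (Fin n) F) (β : B ≃ₐ[F] Matrix (Fin k) (Fin k) F)
    {e : A} (he : IsIdempotentElem e) (he₁ : e ∈ A₁) :
    (β ⟨e, hle he₁⟩).rank * n = (φ ⟨e, he₁⟩).rank * k := by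
  have hid : IsIdempotentElem (⟨e, he₁⟩ : A₁) := Subtype.ext he
  have h := Matrix.rank_map_mul_of_isIdempotentElem hn
    ((β.toAlgHom.comp (Subalgebra.inclusion hle)).comp φ.symm.toAlgHom) (hid.map φ)
  simpa using h

/-- A subalgebra isomorphic to a matrix algebra is spanned by a finite set. -/
theorem Subalgebra.exists_finset_span_eq {F A : Type*} [Field F] [Ring A] [Algebra F A]
    {n : ℕ} {A₁ : Subalgebra F A} (φ : A₁ ≃ₐ[F] Matrix (Fin n) (Fin n) F) :
    ∃ s : Finset A, Submodule.span F (s : Set A) = A₁.toSubmodule := by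
  have : Module.Finite F A₁ := Module.Finite.equiv φ.symm.toLinearEquiv
  exact (Module.Finite.iff_fg (N := A₁.toSubmodule)).mp this


/-- A unital locally matrix algebra over a field `F`: every finite subset lies in a
unital subalgebra isomorphic to a full matrix algebra `M_n(F)` for some `n ≥ 1`. -/
def IsUnitalLocallyMatrix (F : Type*) [Field F] (A : Type*) [Ring A] [Algebra F A] : Prop :=
  ∀ s : Finset A, ∃ (n : ℕ) (B : Subalgebra F A), 1 ≤ n ∧ (↑s : Set A) ⊆ B ∧
    Nonempty (B ≃ₐ[F] Matrix (Fin n) (Fin n) F)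

/-- The relative rank of an idempotent in a unital locally matrix algebra does not depend
on the choice of the unital matrix subalgebra containing it: if `e` lies in subalgebras
`A₁ ≅ M_n(F)` and `A₂ ≅ M_m(F)`, and its images have ranks `r` and `s` respectively,
then `r / n = s / m`, i.e. `r * m = s * n`. -/
theorem relativeRank_well_defined (F : Type*) [Field F]
    (A : Type*) [Ring A] [Algebra F A]
    (hA : IsUnitalLocallyMatrix F A)
    (e : A) (he : IsIdempotentElem e)
    (n m : ℕ) (hn : 1 ≤ n) (hm : 1 ≤ m)
    (A₁ A₂ : Subalgebra F A) (he₁ : e ∈ A₁) (he₂ : e ∈ A₂)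
    (φ : A₁ ≃ₐ[F] Matrix (Fin n) (Fin n) F)
    (ψ : A₂ ≃ₐ[F] Matrix (Fin m) (Fin m) F)
    (r s : ℕ) (hr : r = (φ ⟨e, he₁⟩).rank) (hs : s = (ψ ⟨e, he₂⟩).rank) :
    r * m = s * n := by
  classical
  obtain ⟨S₁, hS₁⟩ := Subalgebra.exists_finset_span_eq φ
  obtain ⟨S₂, hS₂⟩ := Subalgebra.exists_finset_span_eq ψ
  obtain ⟨k, B, hk, hB, ⟨β⟩⟩ := hA (S₁ ∪ S₂)
  rw [Finset.coe_union, Set.union_subset_iff] at hB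
  have hle₁ : A₁ ≤ B := by
    rw [← Subalgebra.toSubmodule.le_iff_le, ← hS₁]
    exact Submodule.span_le.mpr hB.1
  have hle₂ : A₂ ≤ B := by
    rw [← Subalgebra.toSubmodule.le_iff_le, ← hS₂]
    exact Submodule.span_le.mpr hB.2
  have h₁ := Subalgebra.rank_mul_eq_of_le hn hle₁ φ β he he₁
  have h₂ := Subalgebra.rank_mul_eq_of_le hm hle₂ ψ β he he₂
  rw [← hr] at h₁
  rw [← hs] at h₂
  apply Nat.eq_of_mul_eq_mul_right hk
  calc r * m * k = r * k * m := by ring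
    _ = s * k * n := by rw [← h₁, ← h₂]; ring
    _ = s * n * k := by ring
end

section
/- Let A be a unital locally matrix algebra over a field F and let e ∈ A be a nonzero idempotent. Suppose e lies in a unital subalgebra A₁ of A containing 1_A with an F-algebra isomorphism φ : A₁ ≅ M_n(F), and let r be the rank of the matrix φ(e) (so the relative rank of e is r/n). Then the corner eAe is a unital locally matrix algebra over F with unit e, and n·st(eAe) = r·st(A), that is, {m : m divides n·d for some d ∈ D(eAe)} = {m : m divides r·d for some d ∈ D(A)}. -/
/-- `D(A)`: the set of positive integers `n` such that `A` has a unital subalgebra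
(containing `1`) isomorphic to `M_n(F)`. -/
def matrixDegrees (F : Type*) [Field F] (A : Type*) [Ring A] [Algebra F A] : Set ℕ :=
  {n | 1 ≤ n ∧ ∃ B : Subalgebra F A, Nonempty (B ≃ₐ[F] Matrix (Fin n) (Fin n) F)}

section CornerDefs

variable {F : Type*} [Field F] {A : Type*} [Ring A] [Algebra F A]

private lemma corner_mul_left {e x : A} (he : IsIdempotentElem e) (hx : e * x * e = x) :
    e * x = x := by
  calc e * x = e * (e * x * e) := by rw [hx]
  _ = e * e * x * e := by simp only [mul_assoc]
  _ = e * x * e := by rw [he.eq]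
  _ = x := hx

private lemma corner_mul_right {e x : A} (he : IsIdempotentElem e) (hx : e * x * e = x) :
    x * e = x := by
  calc x * e = (e * x * e) * e := by rw [hx]
  _ = e * x * (e * e) := by simp only [mul_assoc]
  _ = e * x * e := by rw [he.eq]
  _ = x := hx

/-- The corner `eAe` of an algebra `A` at an idempotent `e`, as a non-unital subalgebra. -/
def cornerSubalgebra (F : Type*) [Field F] {A : Type*} [Ring A] [Algebra F A]
    (e : A) (he : IsIdempotentElem e) : NonUnitalSubalgebra F A where
  carrier := {x : A | e * x * e = x}
  add_mem' := by
    intro x y hx hy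
    simp only [Set.mem_setOf_eq] at *
    rw [mul_add, add_mul, hx, hy]
  zero_mem' := by simp
  mul_mem' := by
    intro x y hx hy
    simp only [Set.mem_setOf_eq] at *
    calc e * (x * y) * e = (e * x) * (y * e) := by simp only [mul_assoc]
    _ = x * y := by rw [corner_mul_left he hx, corner_mul_right he hy]
  smul_mem' := by
    intro c x hx
    simp only [Set.mem_setOf_eq] at *
    rw [mul_smul_comm, smul_mul_assoc, hx]

/-- The corner `eAe` as a type: the elements `x ∈ A` with `e * x * e = x`. -/
abbrev Corner (F : Type*) [Field F] {A : Type*} [Ring A] [Algebra F A]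
    (e : A) (he : IsIdempotentElem e) : Type _ :=
  cornerSubalgebra F e he

namespace Corner

variable {e : A} {he : IsIdempotentElem e}

/-- The unit of the corner ring `eAe` is `e`. -/
instance : One (Corner F e he) :=
  ⟨⟨e, show e * e * e = e by rw [he.eq, he.eq]⟩⟩

lemma one_def : ((1 : Corner F e he) : A) = e := rfl

/-- The corner `eAe` is a unital ring, with multiplication inherited from `A`
and unit `e`. -/
instance : Ring (Corner F e he) :=
  { (inferInstance : NonUnitalRing (Corner F e he)),
    (inferInstance : One (Corner F e he)) with
    one_mul := by
      rintro ⟨x, hx⟩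
      exact Subtype.ext (corner_mul_left he hx)
    mul_one := by
      rintro ⟨x, hx⟩
      exact Subtype.ext (corner_mul_right he hx) }

/-- The corner `eAe` is a unital `F`-algebra. -/
instance : Algebra F (Corner F e he) :=
  Algebra.ofModule
    (fun c x y => Subtype.ext (smul_mul_assoc c (x : A) (y : A)))
    (fun c x y => Subtype.ext (mul_smul_comm c (x : A) (y : A)))

end Corner

end CornerDefs

lemma LinearMap.finrank_range_rTensor {F V W : Type*} [Field F] [AddCommGroup V] [Module F V]
    [AddCommGroup W] [Module F W] (g : V →ₗ[F] V) :
    Module.finrank F (LinearMap.range (g.rTensor W)) =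
      Module.finrank F (LinearMap.range g) * Module.finrank F W := by
  rw [← Module.finrank_tensorProduct (R := F) (S := F), LinearMap.rTensor_range]
  exact LinearMap.finrank_range_of_inj
    (Module.Flat.rTensor_preserves_injective_linearMap _ (Submodule.subtype_injective _))

open TensorProduct Matrix in
/-- In a finite-dimensional representation of a matrix algebra, the rank of the action of a matrix
is a constant multiple of the rank of the matrix. -/
lemma Matrix.exists_finrank_range_algHom_eq {F V : Type*} [Field F] [AddCommGroup V] [Module F V]
    {k : ℕ} (hk : 1 ≤ k) (f : Matrix (Fin k) (Fin k) F →ₐ[F] Module.End F V) :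
    ∃ ρ : ℕ, ∀ x, Module.finrank F (LinearMap.range (f x)) = x.rank * ρ := by
  let o : Fin k := ⟨0, hk⟩
  let W : Submodule F V := LinearMap.range (f (single o o 1))
  have hW (w : W) : f (single o o 1) (w : V) = w := by
    obtain ⟨_, v, rfl⟩ := w
    simp [← Module.End.mul_apply, ← map_mul]
  let col : (Fin k → F) →ₗ[F] Matrix (Fin k) (Fin k) F :=
    { toFun := fun c ↦ vecMulVec c (Pi.single o 1)
      map_add' := fun c d ↦ add_vecMulVec c d _
      map_smul' := fun a c ↦ smul_vecMulVec a c _ }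
  have hmul (x : Matrix (Fin k) (Fin k) F) (c : Fin k → F) : x * col c = col (x *ᵥ c) :=
    mul_vecMulVec x c _
  have hcol (i : Fin k) : col (Pi.single i 1) = single i o 1 := by
    simp [col, single_eq_single_vecMulVec_single]
  let T : (Fin k → F) ⊗[F] W →ₗ[F] V :=
    TensorProduct.lift ((LinearMap.lcomp F V W.subtype) ∘ₗ f.toLinearMap ∘ₗ col)
  have hT (c : Fin k → F) (w : W) : T (c ⊗ₜ w) = f (col c) w := rfl
  let π (i : Fin k) : V →ₗ[F] W := (f (single o i 1)).codRestrict W fun v ↦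
    ⟨f (single o i 1) v, by simp [← Module.End.mul_apply, ← map_mul]⟩
  let S : V →ₗ[F] (Fin k → F) ⊗[F] W :=
    ∑ i, (TensorProduct.mk F (Fin k → F) W (Pi.single i 1)) ∘ₗ π i
  have hS (v : V) : S v = ∑ i, (Pi.single i 1 : Fin k → F) ⊗ₜ[F] π i v := by
    simp [S]
  have hTS : T ∘ₗ S = LinearMap.id := by
    ext v
    have h1 : ∑ i : Fin k, single i i (1 : F) = 1 := sum_single_one
    simp only [LinearMap.comp_apply, hS, map_sum, hT, hcol, LinearMap.id_apply]
    have h2 (i : Fin k) : f (single i o 1) (π i v) = f (single i i 1) v := by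
      change f (single i o 1) (f (single o i 1) v) = _
      simp [← Module.End.mul_apply, ← map_mul]
    simp only [h2, ← LinearMap.sum_apply, ← map_sum, h1]
    simp
  have hST : S ∘ₗ T = LinearMap.id := by
    refine TensorProduct.ext' fun c w ↦ ?_
    have h (i : Fin k) : π i (f (col c) w) = c i • w := by
      apply Subtype.ext
      have h2 : single o i 1 * col c = c i • single o o 1 := by
        rw [hmul, ← hcol, ← map_smul]
        congr 1
        ext j
        simp [single_mulVec, Pi.single_apply, Function.update_apply]
      change f (single o i 1) (f (col c) w) = c i • (w : V)
      rw [← Module.End.mul_apply, ← map_mul, h2, map_smul, LinearMap.smul_apply, hW]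
    simp only [LinearMap.comp_apply, hS, hT, h, LinearMap.id_apply, ← TensorProduct.smul_tmul,
      ← TensorProduct.sum_tmul]
    congr 1
    ext j
    simp [Finset.sum_apply, Pi.single_apply]
  let e : ((Fin k → F) ⊗[F] W) ≃ₗ[F] V := LinearEquiv.ofLinearMap T S hTS hST
  refine ⟨Module.finrank F W, fun x ↦ ?_⟩
  have hcomm : f x ∘ₗ T = T ∘ₗ x.mulVecLin.rTensor W := by
    refine TensorProduct.ext' fun c w ↦ ?_
    simp [hT, ← hmul]
  have hx : f x = T ∘ₗ x.mulVecLin.rTensor W ∘ₗ S := by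
    rw [← LinearMap.comp_assoc, ← hcomm, LinearMap.comp_assoc, hTS, LinearMap.comp_id]
  rw [Matrix.rank, ← LinearMap.finrank_range_rTensor, hx]
  have : LinearMap.range S = ⊤ := LinearMap.range_eq_top.2 e.symm.surjective
  rw [LinearMap.range_comp, LinearMap.range_comp_of_range_eq_top _ this]
  exact LinearEquiv.finrank_map_eq e _

/-- A unital homomorphism between matrix algebras multiplies ranks by a constant. -/
lemma Matrix.exists_rank_algHom_eq {F : Type*} [Field F] {k l : ℕ} (hk : 1 ≤ k)
    (f : Matrix (Fin k) (Fin k) F →ₐ[F] Matrix (Fin l) (Fin l) F) :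
    ∃ ρ : ℕ, ∀ x, (f x).rank = x.rank * ρ :=
  Matrix.exists_finrank_range_algHom_eq hk (Matrix.toLinAlgEquiv'.toAlgHom.comp f)

lemma Subalgebra.fg_of_algEquiv_matrix {F A : Type*} [Field F] [Ring A] [Algebra F A]
    {B : Subalgebra F A} {k : ℕ} (φ : B ≃ₐ[F] Matrix (Fin k) (Fin k) F) : B.FG := by
  have : Module.Finite F B := Module.Finite.equiv φ.symm.toLinearEquiv
  exact Subalgebra.fg_of_fg_toSubmodule (Module.Finite.iff_fg.1 this)

/-- The corner of a matrix subalgebra at an idempotent of rank `s` is the algebra of `s × s`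
matrices. -/
lemma Corner.exists_subalgebra {F : Type*} [Field F] {A : Type*} [Ring A] [Algebra F A]
    {e : A} (he : IsIdempotentElem e) {B : Subalgebra F A} (heB : e ∈ B) {k : ℕ}
    (φ : B ≃ₐ[F] Matrix (Fin k) (Fin k) F) :
    ∃ B' : Subalgebra F (Corner F e he), (∀ x : Corner F e he, x ∈ B' ↔ (x : A) ∈ B) ∧
      Nonempty (B' ≃ₐ[F] Matrix (Fin (φ ⟨e, heB⟩).rank) (Fin (φ ⟨e, heB⟩).rank) F) := by
  let ψ : B ≃ₐ[F] Module.End F (Fin k → F) := φ.trans Matrix.toLinAlgEquiv'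
  let p := ψ ⟨e, heB⟩
  let R := LinearMap.range p
  let B' : Subalgebra F (Corner F e he) :=
    { carrier := {x | (x : A) ∈ B}
      mul_mem' := fun hx hy ↦ B.mul_mem hx hy
      add_mem' := fun hx hy ↦ B.add_mem hx hy
      algebraMap_mem' := fun c ↦ by
        rw [Algebra.algebraMap_eq_smul_one]
        exact B.smul_mem heB c }
  have hp : p * p = p := by
    rw [← map_mul]; congr 1; exact Subtype.ext he
  have hpR (v : R) : p v = v := by
    obtain ⟨_, v, rfl⟩ := v
    exact LinearMap.congr_fun hp v
  let lift : B' →ₗ[F] B :=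
    { toFun := fun x ↦ ⟨((x : Corner F e he) : A), x.2⟩
      map_add' := fun _ _ ↦ rfl
      map_smul' := fun _ _ ↦ rfl }
  have hl (x : B') : ψ (lift x) = p * ψ (lift x) := by
    rw [← map_mul]; congr 1; exact Subtype.ext (corner_mul_left he x.1.2).symm
  have hr (x : B') : ψ (lift x) = ψ (lift x) * p := by
    rw [← map_mul]; congr 1; exact Subtype.ext (corner_mul_right he x.1.2).symm
  have hmaps (x : B') (v : Fin k → F) : ψ (lift x) v ∈ R :=
    ⟨ψ (lift x) v, (LinearMap.congr_fun (hl x) v).symm⟩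
  let g : B' →ₗ[F] Module.End F R :=
    { toFun := fun x ↦ (ψ (lift x)).restrict fun v _ ↦ hmaps x v
      map_add' := fun x y ↦ by ext; simp
      map_smul' := fun c x ↦ by ext; simp }
  have hg (x : B') (v : R) : ((g x v : R) : Fin k → F) = ψ (lift x) v := rfl
  let G : B' →ₐ[F] Module.End F R := AlgHom.ofLinearMap g
    (by ext v : 2; exact hpR v)
    (fun x y ↦ by
      ext v : 2
      have : lift (x * y) = lift x * lift y := rfl
      rw [hg, this, map_mul]
      rfl)
  have hG : Function.Bijective G := by
    constructor
    · refine (injective_iff_map_eq_zero G).2 fun x hx ↦ ?_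
      have h0 : ψ (lift x) = 0 := by
        refine LinearMap.ext fun v ↦ ?_
        rw [hr]
        exact congrArg Subtype.val (LinearMap.congr_fun hx ⟨p v, v, rfl⟩)
      have h1 : lift x = 0 := (map_eq_zero_iff ψ ψ.injective).1 h0
      exact Subtype.ext (Subtype.ext (congrArg (fun b : B ↦ (b : A)) h1))
    · intro u
      let y : B := ψ.symm (R.subtype ∘ₗ u ∘ₗ p.rangeRestrict)
      have hy : ψ y = R.subtype ∘ₗ u ∘ₗ p.rangeRestrict := ψ.apply_symm_apply _
      have hey : ⟨e, heB⟩ * y * ⟨e, heB⟩ = y := by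
        apply ψ.injective
        rw [map_mul, map_mul, hy]
        refine LinearMap.ext fun v ↦ ?_
        change p (u (p.rangeRestrict (p v))) = u (p.rangeRestrict v)
        rw [hpR]
        congr 2
        exact Subtype.ext (LinearMap.congr_fun hp v)
      refine ⟨⟨⟨y, congrArg Subtype.val hey⟩, y.2⟩, ?_⟩
      ext v : 2
      change ψ y v = u v
      rw [hy]
      change (u (p.rangeRestrict v) : Fin k → F) = u v
      congr 2
      exact Subtype.ext (hpR v)
  exact ⟨B', fun x ↦ Iff.rfl, ⟨(AlgEquiv.ofBijective G hG).trans
    (algEquivMatrix (Module.finBasisOfFinrankEq F R rfl))⟩⟩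

lemma Matrix.exists_rank_algEquiv_eq {F : Type*} [Field F] {A : Type*} [Ring A] [Algebra F A]
    {B C : Subalgebra F A} (h : B ≤ C) {k l : ℕ} (hk : 1 ≤ k)
    (φ : B ≃ₐ[F] Matrix (Fin k) (Fin k) F) (ψ : C ≃ₐ[F] Matrix (Fin l) (Fin l) F) :
    ∃ ρ : ℕ, l = k * ρ ∧ ∀ x : B, (ψ ⟨x, h x.2⟩).rank = (φ x).rank * ρ := by
  obtain ⟨ρ, hρ⟩ := Matrix.exists_rank_algHom_eq hk
    ((ψ.toAlgHom.comp (Subalgebra.inclusion h)).comp φ.symm.toAlgHom)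
  refine ⟨ρ, by simpa using hρ 1, fun x ↦ ?_⟩
  have h := hρ (φ x)
  simp only [AlgHom.comp_apply, AlgEquiv.toAlgHom_apply, AlgEquiv.symm_apply_apply] at h
  exact h

/-- Lemma 2 of the paper: if `e` is a nonzero idempotent of a unital locally matrix
algebra `A`, lying in a unital matrix subalgebra `A₁ ≅ M_n(F)` where the image of `e`
has rank `r` (so `r(e) = r / n`), then the corner `eAe` is a unital locally matrix
algebra with unit `e`, and `st(eAe) = r(e) · st(A)`, i.e. `n · st(eAe) = r · st(A)`,
encoded via divisor sets. -/
theorem steinitz_of_corner (F : Type*) [Field F]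
    (A : Type*) [Ring A] [Algebra F A]
    (hA : IsUnitalLocallyMatrix F A)
    (e : A) (he : IsIdempotentElem e) (hne : e ≠ 0)
    (n : ℕ) (hn : 1 ≤ n) (A₁ : Subalgebra F A) (he₁ : e ∈ A₁)
    (φ : A₁ ≃ₐ[F] Matrix (Fin n) (Fin n) F)
    (r : ℕ) (hr : r = (φ ⟨e, he₁⟩).rank) :
    IsUnitalLocallyMatrix F (Corner F e he) ∧
      {m : ℕ | ∃ d ∈ matrixDegrees F (Corner F e he), m ∣ n * d} =
        {m : ℕ | ∃ d ∈ matrixDegrees F A, m ∣ r * d} := by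
  classical
  have hpos {k : ℕ} {B : Subalgebra F A} (heB : e ∈ B) (ψ : B ≃ₐ[F] Matrix (Fin k) (Fin k) F) :
      1 ≤ (ψ ⟨e, heB⟩).rank := by
    rw [Nat.one_le_iff_ne_zero]
    intro h0
    rw [Matrix.rank, Submodule.finrank_eq_zero, LinearMap.range_eq_bot,
      ← Matrix.mulVecLin_zero] at h0
    have h1 : ψ ⟨e, heB⟩ = 0 := Matrix.mulVec_injective (congrArg DFunLike.coe h0)
    exact hne (congrArg Subtype.val ((map_eq_zero_iff ψ ψ.injective).1 h1))
  refine ⟨fun s ↦ ?_, Set.Subset.antisymm ?_ ?_⟩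
  · obtain ⟨k, B, -, hsB, ⟨ψ⟩⟩ := hA (insert e (s.image Subtype.val))
    have heB : e ∈ B := hsB (by simp)
    obtain ⟨B', hB', hiso⟩ := Corner.exists_subalgebra he heB ψ
    refine ⟨_, B', hpos heB ψ, fun x hx ↦ (hB' x).2 (hsB ?_), hiso⟩
    simp only [Finset.coe_insert, Finset.coe_image]
    exact Or.inr ⟨x, hx, rfl⟩
  · rintro m ⟨d, ⟨hd, C, ⟨χ⟩⟩, hm⟩
    obtain ⟨t, ht⟩ := A₁.fg_of_algEquiv_matrix φ
    obtain ⟨s, hs⟩ := C.fg_of_algEquiv_matrix χ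
    obtain ⟨k, B, hk, hB, ⟨ψ⟩⟩ := hA (t ∪ s.image Subtype.val)
    rw [Finset.coe_union, Set.union_subset_iff, Finset.coe_image] at hB
    have hAB : A₁ ≤ B := ht ▸ Algebra.adjoin_le hB.1
    obtain ⟨B', hB', ⟨ψ'⟩⟩ := Corner.exists_subalgebra he (hAB he₁) ψ
    have hCB : C ≤ B' := hs ▸ Algebra.adjoin_le fun x hx ↦ (hB' x).2 (hB.2 ⟨x, hx, rfl⟩)
    obtain ⟨ρ, hkρ, hρ⟩ := Matrix.exists_rank_algEquiv_eq hAB hn φ ψ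
    obtain ⟨σ, hσ, -⟩ := Matrix.exists_rank_algEquiv_eq hCB hd χ ψ'
    refine ⟨k, ⟨hk, B, ⟨ψ⟩⟩, hm.trans ⟨σ, ?_⟩⟩
    rw [mul_assoc, ← hσ, hρ ⟨e, he₁⟩, ← hr, hkρ]
    ring
  · rintro m ⟨d, ⟨hd, C, ⟨χ⟩⟩, hm⟩
    obtain ⟨t, ht⟩ := A₁.fg_of_algEquiv_matrix φ
    obtain ⟨s, hs⟩ := C.fg_of_algEquiv_matrix χ
    obtain ⟨k, B, hk, hB, ⟨ψ⟩⟩ := hA (t ∪ s)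
    rw [Finset.coe_union, Set.union_subset_iff] at hB
    have hAB : A₁ ≤ B := ht ▸ Algebra.adjoin_le hB.1
    have hCB : C ≤ B := hs ▸ Algebra.adjoin_le hB.2
    obtain ⟨B', -, hiso⟩ := Corner.exists_subalgebra he (hAB he₁) ψ
    obtain ⟨ρ, hkρ, hρ⟩ := Matrix.exists_rank_algEquiv_eq hAB hn φ ψ
    obtain ⟨σ, hσ, -⟩ := Matrix.exists_rank_algEquiv_eq hCB hd χ ψ
    refine ⟨_, ⟨hpos (hAB he₁) ψ, B', hiso⟩, hm.trans ⟨σ, ?_⟩⟩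
    rw [mul_assoc, ← hσ, hρ ⟨e, he₁⟩, ← hr, hkρ]
    ring
end

section
/- Let A and B be unital locally matrix algebras over a field F. If A and B are Morita equivalent, then their Steinitz numbers st(A) and st(B) are rationally connected, i.e., there exist positive integers k and l such that {m : m divides k·d for some d ∈ D(A)} = {m : m divides l·d for some d ∈ D(B)}. -/
/-- Two unital algebras are Morita equivalent if the categories of their left modules
are equivalent. -/
def MoritaEquiv (A : Type u) (B : Type v) [Ring A] [Ring B] : Prop :=
  Nonempty (ModuleCat.{max u v} A ≌ ModuleCat.{max u v} B)

/-- A ring contains a complete system of `m × m` matrix units. -/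
def HasMatrixUnits (m : ℕ) (R : Type*) [Ring R] : Prop :=
  ∃ e : Fin m → Fin m → R,
    (∀ i j k l, e i j * e k l = if j = k then e i l else 0) ∧ ∑ i, e i i = 1

namespace HasMatrixUnits

variable {m : ℕ} {R S : Type*} [Ring R] [Ring S]

theorem map (h : HasMatrixUnits m R) (φ : R →+* S) : HasMatrixUnits m S := by
  obtain ⟨e, he, h1⟩ := h
  refine ⟨fun i j => φ (e i j), fun i j k l => ?_, ?_⟩
  · rw [← map_mul, he]
    split_ifs <;> simp
  · rw [← map_sum, h1, map_one]

theorem unop (h : HasMatrixUnits m Rᵐᵒᵖ) : HasMatrixUnits m R := by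
  obtain ⟨e, he, h1⟩ := h
  refine ⟨fun i j => (e j i).unop, fun i j k l => ?_, ?_⟩
  · rw [← MulOpposite.unop_mul, he]
    by_cases hjk : j = k
    · simp [hjk]
    · simp [hjk, Ne.symm hjk]
  · rw [← Finset.unop_sum, h1, MulOpposite.unop_one]

theorem op (h : HasMatrixUnits m R) : HasMatrixUnits m Rᵐᵒᵖ :=
  (h.map (RingEquiv.opOp R).toRingHom).unop

theorem matrix (m : ℕ) (R : Type*) [Ring R] :
    HasMatrixUnits m (Matrix (Fin m) (Fin m) R) := by
  refine ⟨fun i j => Matrix.single i j 1, fun i j k l => ?_, ?_⟩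
  · split_ifs with h
    · subst h; simp
    · simp [Matrix.single_mul_single_of_ne, h]
  · ext a b
    simp [Matrix.sum_apply, Matrix.single_apply, Matrix.one_apply, ite_and]

theorem dvd_finrank {F V : Type*} [Field F] [AddCommGroup V] [Module F V] [Module.Finite F V]
    (h : HasMatrixUnits m (Module.End F V)) : m ∣ Module.finrank F V := by
  obtain ⟨e, he, h1⟩ := h
  cases m with
  | zero =>
    have : Subsingleton V := by
      refine subsingleton_of_forall_eq 0 fun v => ?_
      simpa using (LinearMap.congr_fun h1 v).symm
    simp [Module.finrank_zero_of_subsingleton]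
  | succ m =>
    have hmul : ∀ i j k l v, e i j (e k l v) = if j = k then e i l v else 0 := by
      intro i j k l v
      rw [← Module.End.mul_apply, he]
      split_ifs <;> simp
    obtain ⟨W, hWe⟩ : ∃ W, W = LinearMap.range (e 0 0) := ⟨_, rfl⟩
    have hW : ∀ w : W, e 0 0 (w : V) = w := by
      subst hWe
      rintro ⟨_, v, rfl⟩
      simp [hmul]
    have hmem : ∀ i v, e 0 i v ∈ W := fun i v => hWe ▸ ⟨e 0 i v, by simp [hmul]⟩
    let E : V ≃ₗ[F] (Fin (m + 1) → W) :=
      LinearEquiv.ofLinearMap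
        (LinearMap.pi fun i => LinearMap.codRestrict W (e 0 i) (hmem i))
        (∑ i, (e i 0) ∘ₗ W.subtype ∘ₗ LinearMap.proj i)
        (by
          refine LinearMap.ext fun w => funext fun i => Subtype.ext ?_
          simp [map_sum, hmul, hW])
        (by
          refine LinearMap.ext fun v => ?_
          simpa [LinearMap.sum_apply, hmul] using LinearMap.congr_fun h1 v)
    rw [E.finrank_eq, Module.finrank_pi_fintype]
    simp

theorem dvd_card {F ι : Type*} [Field F] [Fintype ι] [DecidableEq ι]
    (h : HasMatrixUnits m (Matrix ι ι F)) : m ∣ Fintype.card ι := by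
  simpa using (h.map (Matrix.toLinAlgEquiv' (R := F) (n := ι)).toRingEquiv.toRingHom).dvd_finrank

end HasMatrixUnits

theorem hasMatrixUnits_matrix_iff {F A : Type*} [Field F] [Ring A] [Algebra F A]
    (hA : IsUnitalLocallyMatrix F A) (k m : ℕ) :
    HasMatrixUnits m (Matrix (Fin k) (Fin k) A) ↔ ∃ d ∈ matrixDegrees F A, m ∣ k * d := by
  constructor
  · classical
    rintro ⟨e, he, h1⟩
    obtain ⟨d, S, hd, hS, ⟨φ⟩⟩ :=
      hA (Finset.univ.image fun x : (Fin m × Fin m) × Fin k × Fin k => e x.1.1 x.1.2 x.2.1 x.2.2)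
    refine ⟨d, ⟨hd, S, ⟨φ⟩⟩, ?_⟩
    have hmem : ∀ i j a b, e i j a b ∈ S := fun i j a b =>
      hS (Finset.mem_coe.2 (Finset.mem_image.2 ⟨((i, j), a, b), Finset.mem_univ _, rfl⟩))
    let ι : Matrix (Fin k) (Fin k) S →+* Matrix (Fin k) (Fin k) A := S.val.toRingHom.mapMatrix
    have hι : Function.Injective ι := fun M N h => by
      ext a b
      exact congrFun (congrFun h a) b
    have hlift : HasMatrixUnits m (Matrix (Fin k) (Fin k) S) := by
      let e' : Fin m → Fin m → Matrix (Fin k) (Fin k) S :=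
        fun i j => Matrix.of fun a b => ⟨e i j a b, hmem i j a b⟩
      have hιe : ∀ i j, ι (e' i j) = e i j := fun i j => rfl
      refine ⟨e', fun i j k l => hι ?_, hι ?_⟩
      · rw [map_mul, hιe, hιe, he]
        split_ifs <;> simp [hιe]
      · simp [hιe, h1]
    simpa using ((hlift.map φ.toRingEquiv.mapMatrix.toRingHom).map
      (Matrix.compRingEquiv (Fin k) (Fin d) F).toRingHom).dvd_card
  · rintro ⟨d, ⟨hd, S, ⟨φ⟩⟩, c, hc⟩
    have σ : Fin c × Fin m ≃ Fin k × Fin d :=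
      Fintype.equivOfCardEq (by simp [hc, mul_comm])
    exact ((((((HasMatrixUnits.matrix m F).map (Matrix.scalar (Fin c))).map
      (Matrix.compRingEquiv (Fin c) (Fin m) F).toRingHom).map
      (Matrix.reindexAlgEquiv F F σ).toRingEquiv.toRingHom).map
      (Matrix.compRingEquiv (Fin k) (Fin d) F).symm.toRingHom).map
      φ.symm.toRingEquiv.mapMatrix.toRingHom).map S.val.toRingHom.mapMatrix

/-- An idempotent matrix over a field factors through a space of dimension its rank. -/
theorem exists_rank_factorization {F ι : Type*} [Field F] [Fintype ι] [DecidableEq ι]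
    {e : Matrix ι ι F} (he : e * e = e) :
    ∃ (r : ℕ) (x : Matrix ι (Fin r) F) (y : Matrix (Fin r) ι F), x * y = e ∧ y * x = 1 := by
  let f := Matrix.toLin' e
  have hff : ∀ v, f (f v) = f v := fun v => by
    simp [f, Matrix.mulVec_mulVec, he]
  let W := LinearMap.range f
  let b : W ≃ₗ[F] (Fin (Module.finrank F W) → F) := (Module.finBasis F W).equivFun
  refine ⟨_, LinearMap.toMatrix' (W.subtype ∘ₗ b.symm.toLinearMap),
    LinearMap.toMatrix' (b.toLinearMap ∘ₗ f.rangeRestrict), ?_, ?_⟩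
  · rw [← LinearMap.toMatrix'_comp]
    apply Matrix.toLin'.injective
    rw [Matrix.toLin'_toMatrix']
    ext v
    simp [f]
  · rw [← LinearMap.toMatrix'_comp, ← LinearMap.toMatrix'_id]
    congr 1
    refine LinearMap.ext fun v => ?_
    have : f.rangeRestrict (b.symm v : ι → F) = b.symm v := by
      obtain ⟨w, hw⟩ := (b.symm v).2
      refine Subtype.ext ?_
      change f (b.symm v : ι → F) = b.symm v
      rw [← hw, hff]
    simp [this]

/-- An idempotent matrix over a unital locally matrix algebra becomes equivalent to an identity
matrix after taking a direct sum of copies of it. -/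
theorem exists_idempotent_factorization {F B : Type*} [Field F] [Ring B] [Algebra F B]
    (hB : IsUnitalLocallyMatrix F B) {n : ℕ} {e : Matrix (Fin n) (Fin n) B} (he : e * e = e) :
    ∃ (d r : ℕ) (x : Matrix (Fin n × Fin d) (Fin r) B) (y : Matrix (Fin r) (Fin n × Fin d) B),
      0 < d ∧ y * x = 1 ∧
      ∀ i j s t, (x * y) (i, s) (j, t) = if s = t then e i j else 0 := by
  classical
  obtain ⟨d, S, hd, hS, ⟨φ⟩⟩ :=
    hB (Finset.univ.image fun x : Fin n × Fin n => e x.1 x.2)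
  have hmem : ∀ i j, e i j ∈ S := fun i j =>
    hS (Finset.mem_coe.2 (Finset.mem_image.2 ⟨(i, j), Finset.mem_univ _, rfl⟩))
  let e₁ : Matrix (Fin n) (Fin n) (Matrix (Fin d) (Fin d) F) :=
    Matrix.of fun i j => φ ⟨e i j, hmem i j⟩
  let ψ : Matrix (Fin d) (Fin d) F →+* B := S.val.toRingHom.comp φ.symm.toRingEquiv.toRingHom
  have hψe : ∀ i j, ψ (e₁ i j) = e i j := fun i j => by simp [ψ, e₁]
  have hψ : Function.Injective ψ := fun a b h => φ.symm.injective (Subtype.ext h)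
  have he₁ : e₁ * e₁ = e₁ := by
    ext1 i j
    apply hψ
    rw [hψe, Matrix.mul_apply, map_sum]
    simp only [map_mul, hψe]
    rw [← Matrix.mul_apply, he]
  obtain ⟨r, x, y, hxy, hyx⟩ := exists_rank_factorization
    (e := Matrix.compRingEquiv (Fin n) (Fin d) F e₁) (by rw [← map_mul, he₁])
  refine ⟨d, r,
    Matrix.of fun p t => ψ (Matrix.of fun a b => if b = p.2 then x (p.1, a) t else 0),
    Matrix.of fun t p => ψ (Matrix.of fun a b => if a = p.2 then y t (p.1, b) else 0), hd, ?_, ?_⟩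
  · ext t t'
    have key : ∑ p : Fin n × Fin d,
        ((Matrix.of fun a b => if a = p.2 then y t (p.1, b) else 0) *
          (Matrix.of fun a b => if b = p.2 then x (p.1, a) t' else 0) :
            Matrix (Fin d) (Fin d) F) = if t = t' then 1 else 0 := by
      ext a b
      have := congrFun (congrFun hyx t) t'
      simp only [Matrix.mul_apply, Fintype.sum_prod_type, Matrix.one_apply] at this
      simp only [Matrix.sum_apply, Matrix.mul_apply, Matrix.of_apply, Fintype.sum_prod_type,
        ite_mul, mul_ite, zero_mul, mul_zero]
      by_cases hab : a = b
      · subst hab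
        simp [Finset.sum_ite_irrel, this]
        split_ifs <;> simp
      · have hz : ∀ (i : Fin n) (s c : Fin d), (if b = s then if a = s then
            y t (i, c) * x (i, c) t' else 0 else 0) = 0 := fun i s c => by
          split_ifs with h1 h2
          · exact absurd (h2.trans h1.symm) hab
          all_goals rfl
        simp [hz]
        split_ifs <;> simp [hab]
    simp only [Matrix.mul_apply, Matrix.of_apply, ← map_mul, ← map_sum, key, Matrix.one_apply]
    split_ifs <;> simp
  · intro i j s t
    have key : ∑ u : Fin r,
        ((Matrix.of fun a b => if b = s then x (i, a) u else 0) *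
          (Matrix.of fun a b => if a = t then y u (j, b) else 0) :
            Matrix (Fin d) (Fin d) F) = if s = t then e₁ i j else 0 := by
      ext a b
      have := congrFun (congrFun hxy (i, a)) (j, b)
      simp only [Matrix.mul_apply, Matrix.compRingEquiv_apply, Matrix.comp_apply] at this
      simp only [Matrix.sum_apply, Matrix.mul_apply, Matrix.of_apply,
        ite_mul, mul_ite, zero_mul, mul_zero]
      by_cases hst : s = t
      · subst hst
        simp [this]
      · have hz : ∀ (u : Fin r) (c : Fin d), (if c = t then if c = s then
            x (i, a) u * y u (j, b) else 0 else 0) = 0 := fun u c => by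
          split_ifs with h1 h2
          · exact absurd (h2.symm.trans h1) hst
          all_goals rfl
        simp [hz, hst]
    simp only [Matrix.mul_apply, Matrix.of_apply, ← map_mul, ← map_sum, key]
    split_ifs <;> simp [hψe]

/-- Over a unital locally matrix algebra, some positive power of a finitely generated projective
module is free. The module is presented by a finite dual basis. -/
theorem exists_pi_equiv_of_dualBasis {F B P : Type*} [Field F] [Ring B] [Algebra F B]
    [AddCommGroup P] [Module B P] (hB : IsUnitalLocallyMatrix F B) {n : ℕ}
    (p : Fin n → P) (g : Fin n → P →ₗ[B] B) (hpg : ∀ v, ∑ i, g i v • p i = v) :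
    ∃ d r : ℕ, 0 < d ∧ Nonempty ((Fin d → P) ≃ₗ[B] (Fin r → B)) := by
  let e : Matrix (Fin n) (Fin n) B := Matrix.of fun i j => g j (p i)
  have he : e * e = e := by
    ext i j
    have := congrArg (g j) (hpg (p i))
    simpa [e, Matrix.mul_apply] using this
  obtain ⟨d, r, x, y, hd, hyx, hxy⟩ := exists_idempotent_factorization hB he
  let α : (Fin d → P) →ₗ[B] (Fin r → B) :=
    { toFun := fun v t => ∑ q : Fin n × Fin d, g q.1 (v q.2) * x q t
      map_add' := fun v w => by
        ext t
        simp [add_mul, Finset.sum_add_distrib]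
      map_smul' := fun c v => by
        ext t
        simp [mul_assoc, Finset.mul_sum] }
  let β : (Fin r → B) →ₗ[B] (Fin d → P) :=
    { toFun := fun b s => ∑ i, (∑ t, b t * y t (i, s)) • p i
      map_add' := fun v w => by
        ext s
        simp [add_mul, Finset.sum_add_distrib, add_smul]
      map_smul' := fun c v => by
        ext s
        simp [mul_assoc, ← Finset.mul_sum, Finset.smul_sum, mul_smul] }
  have hex : ∀ j s t, ∑ i, e j i * x (i, s) t = x (j, s) t := by
    intro j s t
    have h : (x * y) * x = x := by rw [Matrix.mul_assoc, hyx, Matrix.mul_one]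
    have := congrFun (congrFun h (j, s)) t
    rw [Matrix.mul_apply, Fintype.sum_prod_type] at this
    simpa [hxy] using this
  refine ⟨d, r, hd, ⟨LinearEquiv.ofLinearMap α β ?_ ?_⟩⟩
  · refine LinearMap.ext fun b => funext fun t => ?_
    have h1 : ∀ q : Fin n × Fin d, g q.1 (β b q.2) =
        ∑ j, (∑ u, b u * y u (j, q.2)) * e j q.1 := fun q => by
      simp [β, e, map_sum]
    calc α (β b) t = ∑ q : Fin n × Fin d, (∑ j, (∑ u, b u * y u (j, q.2)) * e j q.1) * x q t := by
          simp only [← h1]; rfl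
      _ = ∑ s, ∑ j, (∑ u, b u * y u (j, s)) * ∑ i, e j i * x (i, s) t := by
          rw [Fintype.sum_prod_type, Finset.sum_comm]
          refine Finset.sum_congr rfl fun s _ => ?_
          simp only [Finset.sum_mul _ _ (x _ _), Finset.mul_sum, mul_assoc]
          rw [Finset.sum_comm]
      _ = ∑ u, b u * (y * x) u t := by
          simp only [hex, Matrix.mul_apply, Fintype.sum_prod_type, Finset.sum_mul, Finset.mul_sum,
            mul_assoc]
          rw [Finset.sum_comm]
          simp_rw [Finset.sum_comm (s := (Finset.univ : Finset (Fin d)))]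
          rw [Finset.sum_comm]
      _ = b t := by simp [hyx, Matrix.one_apply]
  · refine LinearMap.ext fun v => funext fun s => ?_
    calc β (α v) s = ∑ i, (∑ q : Fin n × Fin d, g q.1 (v q.2) * (x * y) q (i, s)) • p i := by
          change ∑ i, (∑ t, α v t * y t (i, s)) • p i = _
          refine Finset.sum_congr rfl fun i _ => ?_
          congr 1
          simp only [α, LinearMap.coe_mk, AddHom.coe_mk, Matrix.mul_apply, Finset.sum_mul,
            Finset.mul_sum, mul_assoc]
          rw [Finset.sum_comm]
      _ = ∑ i, (∑ j, g j (v s) * e j i) • p i := by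
          simp [Fintype.sum_prod_type, hxy]
      _ = ∑ i, g i (v s) • p i := by
          refine Finset.sum_congr rfl fun i _ => ?_
          congr 1
          have := congrArg (g i) (hpg (v s))
          simpa [e] using this
      _ = v s := hpg _

open CategoryTheory in
/-- A Morita equivalence sends the regular module to a module with a finite dual basis and the
same endomorphism ring. -/
theorem MoritaEquiv.exists_dualBasis {A : Type u} {B : Type v} [Ring A] [Ring B]
    (h : MoritaEquiv A B) :
    ∃ (P : ModuleCat.{max u v} B) (n : ℕ) (p : Fin n → P) (g : Fin n → P →ₗ[B] B),
      (∀ v, ∑ i, g i v • p i = v) ∧ Nonempty (Aᵐᵒᵖ ≃+* Module.End B P) := by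
  obtain ⟨E⟩ := h
  let A' : ModuleCat.{max u v} A := ModuleCat.of A (ULift.{v} A)
  let B' : ModuleCat.{max u v} B := ModuleCat.of B (ULift.{u} B)
  have : E.functor.Additive := Functor.additive_of_preserves_binary_products E.functor
  let H := E.symm.toAdjunction.homEquiv
  let T : Submodule A A' := Submodule.span A {a | ∃ (f : E.inverse.obj B' ⟶ A') (x : _), f x = a}
  have hT : T = ⊤ := by
    let π : A' ⟶ ModuleCat.of A (A' ⧸ T) := ModuleCat.ofHom T.mkQ
    suffices hπ : E.functor.map π = 0 by
      have : π = 0 := E.functor.map_injective (by rw [hπ, E.functor.map_zero])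
      have h' : T.mkQ = 0 := by
        have := congrArg ModuleCat.Hom.hom this
        simpa [π] using this
      rw [← Submodule.ker_mkQ T, h', LinearMap.ker_zero]
    ext z
    let k : B' ⟶ E.functor.obj A' :=
      ModuleCat.ofHom ((LinearMap.toSpanSingleton B _ z).comp ULift.moduleEquiv.toLinearMap)
    have hk : k ≫ E.functor.map π = 0 := by
      let f : E.inverse.obj B' ⟶ A' := (H B' A').symm k
      have hf : f ≫ π = 0 := by
        ext x
        exact (Submodule.Quotient.mk_eq_zero T).2 (Submodule.subset_span ⟨f, x, rfl⟩)
      have h1 := E.symm.toAdjunction.homEquiv_naturality_right f π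
      rw [hf] at h1
      have h2 : H B' A' f = k := (H B' A').apply_symm_apply k
      change H _ _ 0 = H B' A' f ≫ E.functor.map π at h1
      rw [h2] at h1
      rw [← h1]
      simp only [H, Adjunction.homEquiv_unit]
      erw [E.functor.map_zero, Limits.comp_zero]
    have := ConcreteCategory.congr_hom hk (ULift.up (1 : B))
    change E.functor.map π ((1 : B) • z) = 0 at this
    rwa [one_smul] at this
  have h1 : (ULift.up (1 : A) : A') ∈ T := hT ▸ Submodule.mem_top
  obtain ⟨n, c, w, hw⟩ := Submodule.mem_span_set'.1 h1
  choose f x hfx using fun i => (w i).2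
  let g : Fin n → (A' ⟶ E.inverse.obj B') := fun i =>
    ModuleCat.ofHom ((LinearMap.toSpanSingleton A _ (c i • x i)).comp
      ULift.moduleEquiv.toLinearMap)
  have hgf : ∑ i, g i ≫ f i = 𝟙 A' := by
    ext a
    rw [ModuleCat.hom_sum, LinearMap.sum_apply]
    have : ∀ i, (g i ≫ f i).hom a = a.down • c i • (w i : A') := fun i => by
      rw [← hfx i]
      change f i (a.down • c i • x i) = _
      rw [map_smul, map_smul]
    simp only [this, ← Finset.smul_sum, hw]
    exact mul_one a.down
  let ε : E.functor.obj (E.inverse.obj B') ≅ B' := E.counitIso.app B'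
  refine ⟨E.functor.obj A', n,
    fun i => E.functor.map (f i) (ε.inv (ULift.up (1 : B))),
    fun i => ULift.moduleEquiv.toLinearMap.comp (E.functor.map (g i) ≫ ε.hom).hom, ?_, ?_⟩
  · intro v
    have h2 : ∑ i, E.functor.map (g i) ≫ E.functor.map (f i) = 𝟙 _ := by
      rw [← E.functor.map_id, ← hgf, Functor.map_sum]
      simp
    have h3 := ConcreteCategory.congr_hom h2 v
    change (∑ i, E.functor.map (g i) ≫ E.functor.map (f i)).hom v = v at h3
    rw [ModuleCat.hom_sum, LinearMap.sum_apply] at h3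
    refine Eq.trans (Finset.sum_congr rfl fun i _ => ?_) h3
    have h4 : ∀ y : B', y.down • ε.inv (ULift.up (1 : B)) = ε.inv y := fun y => by
      rw [← map_smul]
      exact congrArg ε.inv (ULift.ext _ _ (mul_one y.down))
    change (ε.hom (E.functor.map (g i) v)).down • _ = E.functor.map (f i) (E.functor.map (g i) v)
    rw [← map_smul, h4]
    congr 1
    exact ConcreteCategory.congr_hom ε.hom_inv_id (E.functor.map (g i) v)
  · let Φ : End A' ≃+* End (E.functor.obj A') :=
      { E.fullyFaithfulFunctor.homEquiv with
        map_mul' := fun x y => E.functor.map_comp y x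
        map_add' := fun x y => E.functor.map_add }
    exact ⟨(RingEquiv.moduleEndSelf A).trans <|
      (ULift.moduleEquiv (R := A) (M := A)).symm.conjRingEquiv.trans <|
      (ModuleCat.endRingEquiv A').symm.trans <| Φ.trans <| ModuleCat.endRingEquiv _⟩

/-- If unital locally matrix algebras `A`, `B` are Morita equivalent, then their Steinitz
numbers are rationally connected: there exist positive integers `k`, `l` with
`k · st(A) = l · st(B)`, encoded by equality of divisor sets. -/
theorem morita_equivalent_implies_rationally_connected
    (F : Type*) [Field F]
    (A : Type u) (B : Type v) [Ring A] [Ring B] [Algebra F A] [Algebra F B]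
    (hA : IsUnitalLocallyMatrix F A) (hB : IsUnitalLocallyMatrix F B)
    (hMorita : MoritaEquiv A B) :
    ∃ k l : ℕ, 0 < k ∧ 0 < l ∧
      {m : ℕ | ∃ d ∈ matrixDegrees F A, m ∣ k * d} =
        {m : ℕ | ∃ d ∈ matrixDegrees F B, m ∣ l * d} := by
  obtain ⟨P, n, p, g, hpg, ⟨φ⟩⟩ := hMorita.exists_dualBasis
  obtain ⟨d, r, hd, ⟨ψ⟩⟩ := exists_pi_equiv_of_dualBasis hB p g hpg
  let Θ : (Matrix (Fin d) (Fin d) A)ᵐᵒᵖ ≃+* (Matrix (Fin r) (Fin r) B)ᵐᵒᵖ :=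
    RingEquiv.mopMatrix.symm.trans <| φ.mapMatrix.trans <|
      (endVecRingEquivMatrixEnd (Fin d) B P).symm.trans <| ψ.conjRingEquiv.trans <|
      (endVecRingEquivMatrixEnd (Fin r) B B).trans <|
      (RingEquiv.moduleEndSelf B).symm.mapMatrix.trans RingEquiv.mopMatrix
  have hA1 : Nontrivial A := by
    obtain ⟨n, S, hn, -, ⟨σ⟩⟩ := hA ∅
    have : NeZero n := ⟨by lia⟩
    have := σ.symm.injective.nontrivial
    exact (Subtype.val_injective : Function.Injective ((↑) : S → A)).nontrivial
  have hr : 0 < r := by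
    refine Nat.pos_of_ne_zero fun hr => ?_
    subst hr
    have : NeZero d := ⟨hd.ne'⟩
    have := Θ.injective.nontrivial
    exact not_subsingleton (Matrix (Fin 0) (Fin 0) B)ᵐᵒᵖ inferInstance
  refine ⟨d, r, hd, hr, Set.ext fun m => ?_⟩
  rw [Set.mem_ofPred_eq, Set.mem_ofPred_eq, ← hasMatrixUnits_matrix_iff hA,
    ← hasMatrixUnits_matrix_iff hB]
  exact ⟨fun h => (h.op.map Θ.toRingHom).unop, fun h => (h.op.map Θ.symm.toRingHom).unop⟩
end

section
/- Let A₁ and A₂ be Morita equivalent unital locally matrix algebras over a field F, each of dimension at most ℵ₀ over F. Then st(A₁)/st(A₂) < 1 — i.e., there exist positive integers l < k with {m : m divides k·d for some d ∈ D(A₁)} = {m : m divides l·d for some d ∈ D(A₂)} — if and only if A₁ is isomorphic as an F-algebra to a proper corner e A₂ e of A₂, where e ∈ A₂ is an idempotent with e ≠ 0 and e ≠ 1. -/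
open scoped Kronecker

namespace Matrix

variable {F : Type*} [Field F]

/-- An idempotent matrix factors through its range. -/
lemma exists_rectangular_factorization_of_isIdempotentElem {n : Type*} [Fintype n] [DecidableEq n]
    {e : Matrix n n F} (he : IsIdempotentElem e) :
    ∃ (r : ℕ) (p : Matrix n (Fin r) F) (q : Matrix (Fin r) n F), p * q = e ∧ q * p = 1 := by
  set f : (n → F) →ₗ[F] (n → F) := Matrix.toLin' e with hf
  have hff : ∀ x, f (f x) = f x := fun x => by
    rw [hf, ← Matrix.toLin'_mul_apply, he.eq]
  let b := Module.finBasis F f.range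
  let P : f.range →ₗ[F] (n → F) := f.range.subtype
  let Q : (n → F) →ₗ[F] f.range := f.rangeRestrict
  have hPQ : P ∘ₗ Q = f := by ext; rfl
  have hQP : Q ∘ₗ P = LinearMap.id := by
    ext ⟨x, y, rfl⟩ : 1
    exact Subtype.ext (hff y)
  refine ⟨_, LinearMap.toMatrix b (Pi.basisFun F n) P, LinearMap.toMatrix (Pi.basisFun F n) b Q,
    ?_, ?_⟩
  · rw [← LinearMap.toMatrix_comp, hPQ, LinearMap.toMatrix_eq_toMatrix', hf,
      LinearMap.toMatrix'_toLin']
  · rw [← LinearMap.toMatrix_comp, hQP, LinearMap.toMatrix_id]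

/-- Every unital homomorphism between matrix algebras is conjugate to `x ↦ x ⊗ 1`. -/
lemma exists_algHom_eq_conj_kronecker_one {n m : ℕ} [NeZero n]
    (f : Matrix (Fin n) (Fin n) F →ₐ[F] Matrix (Fin m) (Fin m) F) :
    ∃ (t : ℕ) (P : Matrix (Fin m) (Fin n × Fin t) F) (Q : Matrix (Fin n × Fin t) (Fin m) F),
      P * Q = 1 ∧ Q * P = 1 ∧ ∀ x, f x = P * (x ⊗ₖ (1 : Matrix (Fin t) (Fin t) F)) * Q := by
  have he : IsIdempotentElem (f (single 0 0 1)) := by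
    rw [IsIdempotentElem, ← map_mul, single_mul_single_same, mul_one]
  obtain ⟨t, p, q, hpq, hqp⟩ := exists_rectangular_factorization_of_isIdempotentElem he
  let P : Matrix (Fin m) (Fin n × Fin t) F := of fun x i => (f (single i.1 0 1) * p) x i.2
  let Q : Matrix (Fin n × Fin t) (Fin m) F := of fun i x => (q * f (single 0 i.1 1)) i.2 x
  have hPQ : P * Q = 1 := by
    have h1 : P * Q = ∑ i, (f (single i 0 1) * p) * (q * f (single 0 i 1)) := by
      ext x y
      simp only [P, Q, mul_apply (M := P), of_apply, Fintype.sum_prod_type, sum_apply]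
      rfl
    rw [h1, ← map_one f, ← sum_single_one, map_sum]
    refine Finset.sum_congr rfl fun i _ => ?_
    rw [Matrix.mul_assoc, ← Matrix.mul_assoc p, hpq, ← map_mul, ← map_mul]
    simp
  have hQP : Q * P = 1 := by
    ext ⟨i, s⟩ ⟨j, u⟩
    have h1 : (Q * P) (i, s) (j, u) =
        ((q * f (single 0 i 1)) * (f (single j 0 1) * p)) s u := rfl
    rw [h1, Matrix.mul_assoc, ← Matrix.mul_assoc (f _), ← map_mul]
    by_cases hij : i = j
    · subst hij
      rw [single_mul_single_same, mul_one, ← hpq, Matrix.mul_assoc p, hqp, Matrix.mul_one, hqp]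
      simp [one_apply]
    · rw [single_mul_single_of_ne _ _ _ _ hij]
      simp [hij]
  refine ⟨t, P, Q, hPQ, hQP, fun x => ?_⟩
  have key : f x * P = P * (x ⊗ₖ (1 : Matrix (Fin t) (Fin t) F)) := by
    ext y ⟨j, s⟩
    have h1 : (f x * P) y (j, s) = (f x * (f (single j 0 1) * p)) y s := rfl
    have h2 : x * single j 0 1 = ∑ i, x i j • (single i (0 : Fin n) (1 : F)) := by
      ext a b
      by_cases hb : b = 0
      · subst hb
        simp [sum_apply, single_apply]
      · simp [sum_apply, hb, Ne.symm hb]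
    rw [h1, ← Matrix.mul_assoc, ← map_mul, h2, map_sum, Matrix.sum_mul]
    simp only [map_smul, Matrix.smul_mul, sum_apply, smul_apply, smul_eq_mul]
    simp only [mul_apply (M := P), Fintype.sum_prod_type, kronecker_apply, one_apply, P, of_apply]
    simp [mul_comm]
  rw [← key, Matrix.mul_assoc, hPQ, Matrix.mul_one]

lemma card_eq_of_mul_eq_one {m : ℕ} {κ : Type*} [Fintype κ] [DecidableEq κ]
    {P : Matrix (Fin m) κ F} {Q : Matrix κ (Fin m) F}
    (h : P * Q = 1) (h' : Q * P = 1) : m = Fintype.card κ := by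
  exact (by simpa using square_of_invertible Q P h' h : Fintype.card κ = m).symm

/-- Any two unital homomorphisms between matrix algebras are conjugate. -/
lemma exists_units_conj_of_algHom {n m : ℕ} [NeZero n]
    (f g : Matrix (Fin n) (Fin n) F →ₐ[F] Matrix (Fin m) (Fin m) F) :
    ∃ u : (Matrix (Fin m) (Fin m) F)ˣ, ∀ x, u * f x = g x * u := by
  obtain ⟨t, P, Q, hPQ, hQP, hf⟩ := exists_algHom_eq_conj_kronecker_one f
  obtain ⟨t', P', Q', hPQ', hQP', hg⟩ := exists_algHom_eq_conj_kronecker_one g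
  have h1 := card_eq_of_mul_eq_one hPQ hQP
  have h2 := card_eq_of_mul_eq_one hPQ' hQP'
  simp only [Fintype.card_prod, Fintype.card_fin] at h1 h2
  obtain rfl : t = t' := Nat.eq_of_mul_eq_mul_left (NeZero.pos n) (h1.symm.trans h2)
  have cancel : ∀ {P₁ P₂ : Matrix (Fin m) (Fin n × Fin t) F}
      {Q₁ Q₂ : Matrix (Fin n × Fin t) (Fin m) F}, Q₁ * P₂ = 1 →
      (P₁ * Q₁) * (P₂ * Q₂) = P₁ * Q₂ := fun {P₁ P₂ Q₁ Q₂} h => by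
    rw [Matrix.mul_assoc, ← Matrix.mul_assoc Q₁, h, Matrix.one_mul]
  refine ⟨⟨P' * Q, P * Q', by rw [cancel hQP, hPQ'], by rw [cancel hQP', hPQ]⟩, fun x => ?_⟩
  rw [hf, hg]
  change P' * Q * (P * _ * Q) = P' * _ * Q' * (P' * Q)
  rw [cancel hQP', Matrix.mul_assoc P, cancel hQP, Matrix.mul_assoc]

/-- The unital embedding `x ↦ x ⊗ 1` of `M_n` into `M_{nt}`. -/
lemma nonempty_algHom_mul (n t : ℕ) :
    Nonempty (Matrix (Fin n) (Fin n) F →ₐ[F] Matrix (Fin (n * t)) (Fin (n * t)) F) :=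
  ⟨(reindexAlgEquiv F F finProdFinEquiv).toAlgHom.comp
    (AlgHom.ofLinearMap
      { toFun := fun x => x ⊗ₖ (1 : Matrix (Fin t) (Fin t) F)
        map_add' := fun x y => add_kronecker x y _
        map_smul' := fun c x => smul_kronecker c x _ }
      one_kronecker_one
      (fun x y => by simp [← mul_kronecker_mul]))⟩

end Matrix

section LocallyMatrix

variable {F : Type*} [Field F] {A : Type*} [Ring A] [Algebra F A]

lemma IsUnitalLocallyMatrix.nontrivial (h : IsUnitalLocallyMatrix F A) : Nontrivial A := by
  obtain ⟨n, B, hn, -, ⟨f⟩⟩ := h ∅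
  have : NeZero n := ⟨by omega⟩
  have : Nontrivial B := f.toEquiv.nontrivial
  exact Subtype.val_injective.nontrivial (α := B)

lemma matrix_algHom_injective [Nontrivial A] {n : ℕ} [NeZero n]
    (φ : Matrix (Fin n) (Fin n) F →ₐ[F] A) : Function.Injective φ :=
  φ.toRingHom.injective

lemma mem_matrixDegrees_iff [Nontrivial A] {n : ℕ} :
    n ∈ matrixDegrees F A ↔ 1 ≤ n ∧ Nonempty (Matrix (Fin n) (Fin n) F →ₐ[F] A) := by
  refine and_congr_right fun hn => ?_
  have : NeZero n := ⟨by omega⟩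
  constructor
  · rintro ⟨B, ⟨f⟩⟩
    exact ⟨B.val.comp f.symm.toAlgHom⟩
  · rintro ⟨φ⟩
    exact ⟨φ.range, ⟨(AlgEquiv.ofInjective φ (matrix_algHom_injective φ)).symm⟩⟩

lemma isUnitalLocallyMatrix_iff [Nontrivial A] :
    IsUnitalLocallyMatrix F A ↔ ∀ s : Finset A, ∃ (n : ℕ) (_ : NeZero n)
      (φ : Matrix (Fin n) (Fin n) F →ₐ[F] A), (s : Set A) ⊆ Set.range φ := by
  refine forall_congr' fun s => ?_
  constructor
  · rintro ⟨n, B, hn, hs, ⟨f⟩⟩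
    refine ⟨n, ⟨by omega⟩, B.val.comp f.symm.toAlgHom, fun x hx => ⟨f ⟨x, hs hx⟩, ?_⟩⟩
    simp
  · rintro ⟨n, hn, φ, hs⟩
    exact ⟨n, φ.range, NeZero.one_le, fun x hx => hs hx,
      ⟨(AlgEquiv.ofInjective φ (matrix_algHom_injective φ)).symm⟩⟩

lemma exists_comp_eq_of_range_subset [Nontrivial A] {n N : ℕ} [NeZero N]
    (φ : Matrix (Fin n) (Fin n) F →ₐ[F] A) (Φ : Matrix (Fin N) (Fin N) F →ₐ[F] A)
    (h : ∀ x, φ x ∈ Set.range Φ) :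
    ∃ ι : Matrix (Fin n) (Fin n) F →ₐ[F] Matrix (Fin N) (Fin N) F, ∀ x, Φ (ι x) = φ x := by
  let E := AlgEquiv.ofInjective Φ (matrix_algHom_injective Φ)
  refine ⟨E.symm.toAlgHom.comp (φ.codRestrict Φ.range h), fun x => ?_⟩
  have : ((E (E.symm (φ.codRestrict Φ.range h x)) : Φ.range) : A) = φ x := by
    rw [E.apply_symm_apply]; rfl
  exact this

lemma mem_range_of_single_mem_range {n N : ℕ}
    (φ : Matrix (Fin n) (Fin n) F →ₐ[F] A) (Φ : Matrix (Fin N) (Fin N) F →ₐ[F] A)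
    (h : ∀ i j, φ (Matrix.single i j 1) ∈ Set.range Φ) (x) : φ x ∈ Set.range Φ := by
  change φ x ∈ Φ.range
  rw [Matrix.matrix_eq_sum_single x]
  simp only [map_sum]
  refine sum_mem fun i _ => sum_mem fun j _ => ?_
  rw [← mul_one (x i j), ← smul_eq_mul, ← Matrix.smul_single, map_smul]
  exact Subalgebra.smul_mem _ (h i j) _

/-- In a locally matrix algebra, a matrix subalgebra and a finite set lie in a common matrix
subalgebra. -/
lemma IsUnitalLocallyMatrix.exists_extension (hA : IsUnitalLocallyMatrix F A) (s : Finset A)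
    {n : ℕ} (φ : Matrix (Fin n) (Fin n) F →ₐ[F] A) :
    ∃ (N : ℕ) (_ : NeZero N) (Φ : Matrix (Fin N) (Fin N) F →ₐ[F] A)
      (ι : Matrix (Fin n) (Fin n) F →ₐ[F] Matrix (Fin N) (Fin N) F),
      (s : Set A) ⊆ Set.range Φ ∧ ∀ x, Φ (ι x) = φ x := by
  classical
  have := hA.nontrivial
  obtain ⟨N, hN, Φ, hΦ⟩ := isUnitalLocallyMatrix_iff.1 hA
    (s ∪ Finset.univ.image fun ij : Fin n × Fin n => φ (Matrix.single ij.1 ij.2 1))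
  obtain ⟨ι, hι⟩ := exists_comp_eq_of_range_subset φ Φ
    (mem_range_of_single_mem_range φ Φ fun i j => hΦ (by
      simp only [Finset.coe_union, Set.mem_union, Finset.mem_coe, Finset.mem_image]
      exact Or.inr ⟨(i, j), Finset.mem_univ _, rfl⟩))
  exact ⟨N, hN, Φ, ι, fun x hx => hΦ (by simp [Finset.mem_coe.1 hx]), hι⟩

/-- Any two unital embeddings of a matrix algebra in a locally matrix algebra are conjugate. -/
lemma IsUnitalLocallyMatrix.exists_units_conj (hA : IsUnitalLocallyMatrix F A)
    {n : ℕ} [NeZero n] (φ ψ : Matrix (Fin n) (Fin n) F →ₐ[F] A) :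
    ∃ u : Aˣ, ∀ x, u * φ x = ψ x * u := by
  classical
  have := hA.nontrivial
  obtain ⟨N, hN, Φ, ι, hs, hι⟩ := hA.exists_extension
    (Finset.univ.image fun ij : Fin n × Fin n => ψ (Matrix.single ij.1 ij.2 1)) φ
  obtain ⟨κ, hκ⟩ := exists_comp_eq_of_range_subset ψ Φ
    (mem_range_of_single_mem_range ψ Φ fun i j => hs (by
      simp only [Finset.mem_coe, Finset.mem_image]
      exact ⟨(i, j), Finset.mem_univ _, rfl⟩))
  obtain ⟨u, hu⟩ := Matrix.exists_units_conj_of_algHom ι κ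
  refine ⟨Units.map (Φ : _ →* A) u, fun x => ?_⟩
  have := congrArg Φ (hu x)
  rw [map_mul, map_mul, hι, hκ] at this
  exact this

lemma mem_matrixDegrees_of_dvd [Nontrivial A] {m n : ℕ} (hn : n ∈ matrixDegrees F A)
    (h : m ∣ n) : m ∈ matrixDegrees F A := by
  obtain ⟨t, rfl⟩ := h
  obtain ⟨h1, ⟨φ⟩⟩ := mem_matrixDegrees_iff.1 hn
  obtain ⟨ι⟩ := Matrix.nonempty_algHom_mul (F := F) m t
  exact mem_matrixDegrees_iff.2 ⟨Nat.pos_of_mul_pos_right h1, ⟨φ.comp ι⟩⟩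

lemma dvd_of_algHom_matrix {n m : ℕ} [NeZero n]
    (f : Matrix (Fin n) (Fin n) F →ₐ[F] Matrix (Fin m) (Fin m) F) : n ∣ m := by
  obtain ⟨t, P, Q, hPQ, hQP, -⟩ := Matrix.exists_algHom_eq_conj_kronecker_one f
  have := Matrix.card_eq_of_mul_eq_one hPQ hQP
  simp only [Fintype.card_prod, Fintype.card_fin] at this
  exact ⟨t, this⟩

lemma IsUnitalLocallyMatrix.one_mem_matrixDegrees (hA : IsUnitalLocallyMatrix F A) :
    1 ∈ matrixDegrees F A := by
  have := hA.nontrivial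
  obtain ⟨n, B, hn, -, hB⟩ := hA ∅
  exact mem_matrixDegrees_of_dvd ⟨hn, B, hB⟩ (one_dvd n)

lemma matrixDegrees_congr {B : Type*} [Ring B] [Algebra F B] [Nontrivial A] (f : A ≃ₐ[F] B) :
    matrixDegrees F A = matrixDegrees F B := by
  have : Nontrivial B := f.symm.toEquiv.nontrivial
  ext n
  rw [mem_matrixDegrees_iff, mem_matrixDegrees_iff]
  exact and_congr_right fun _ =>
    ⟨fun ⟨φ⟩ => ⟨f.toAlgHom.comp φ⟩, fun ⟨φ⟩ => ⟨f.symm.toAlgHom.comp φ⟩⟩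

end LocallyMatrix

section Isomorphism

variable {F : Type*} [Field F] {A : Type*} [Ring A] [Algebra F A]
  {B : Type*} [Ring B] [Algebra F B]

/-- Given compatible embeddings of `M_n` in `A` and `B`, one can enlarge the matrix algebra so
that a given element of `A` is attained. -/
lemma exists_extension_pair (hA : IsUnitalLocallyMatrix F A) (hB : IsUnitalLocallyMatrix F B)
    (hD : matrixDegrees F A ⊆ matrixDegrees F B) {n : ℕ} [NeZero n]
    (φ : Matrix (Fin n) (Fin n) F →ₐ[F] A) (ψ : Matrix (Fin n) (Fin n) F →ₐ[F] B) (a : A) :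
    ∃ (N : ℕ) (_ : NeZero N) (Φ : Matrix (Fin N) (Fin N) F →ₐ[F] A)
      (Ψ : Matrix (Fin N) (Fin N) F →ₐ[F] B), a ∈ Set.range Φ ∧
      ∀ x, ∃ y, Φ y = φ x ∧ Ψ y = ψ x := by
  have := hA.nontrivial
  have := hB.nontrivial
  obtain ⟨N, hN, Φ, ι, hs, hι⟩ := hA.exists_extension {a} φ
  obtain ⟨-, ⟨Ψ⟩⟩ := mem_matrixDegrees_iff.1
    (hD (mem_matrixDegrees_iff.2 ⟨NeZero.one_le (n := N), ⟨Φ⟩⟩))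
  obtain ⟨u, hu⟩ := hB.exists_units_conj (Ψ.comp ι) ψ
  refine ⟨N, hN, Φ, (MulSemiringAction.toAlgEquiv F B (ConjAct.toConjAct u)).toAlgHom.comp Ψ,
    hs (by simp), fun x => ⟨ι x, hι x, ?_⟩⟩
  have h1 := hu x
  rw [AlgHom.comp_apply] at h1
  change ConjAct.toConjAct u • Ψ (ι x) = _
  rw [ConjAct.units_smul_def, ConjAct.ofConjAct_toConjAct, h1, Units.mul_inv_cancel_right]

/-- Subalgebras of `A × B` which are the graph of an isomorphism of matrix subalgebras. -/
abbrev MatrixGraph (F A B : Type*) [Field F] [Ring A] [Algebra F A] [Ring B] [Algebra F B] :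
    Type _ :=
  {G : Subalgebra F (A × B) // ∃ (n : ℕ) (_ : NeZero n) (φ : Matrix (Fin n) (Fin n) F →ₐ[F] A)
    (ψ : Matrix (Fin n) (Fin n) F →ₐ[F] B), (φ.prod ψ).range = G}

lemma MatrixGraph.exists_ge (hA : IsUnitalLocallyMatrix F A) (hB : IsUnitalLocallyMatrix F B)
    (hD : matrixDegrees F A = matrixDegrees F B) (G : MatrixGraph F A B) (c : A ⊕ B) :
    ∃ G' : MatrixGraph F A B, G ≤ G' ∧
      Sum.elim (fun a => ∃ b, (a, b) ∈ G'.1) (fun b => ∃ a, (a, b) ∈ G'.1) c := by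
  obtain ⟨_, n, hn, φ, ψ, rfl⟩ := G
  cases c with
  | inl a =>
    obtain ⟨N, hN, Φ, Ψ, ⟨y, hy⟩, hx⟩ := exists_extension_pair hA hB hD.le φ ψ a
    refine ⟨⟨_, N, hN, Φ, Ψ, rfl⟩, ?_, Ψ y, y, Prod.ext hy rfl⟩
    rintro _ ⟨x, rfl⟩
    obtain ⟨z, h1, h2⟩ := hx x
    exact ⟨z, Prod.ext h1 h2⟩
  | inr b =>
    obtain ⟨N, hN, Ψ, Φ, ⟨y, hy⟩, hx⟩ := exists_extension_pair hB hA hD.ge ψ φ b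
    refine ⟨⟨_, N, hN, Φ, Ψ, rfl⟩, ?_, Φ y, y, Prod.ext rfl hy⟩
    rintro _ ⟨x, rfl⟩
    obtain ⟨z, h1, h2⟩ := hx x
    exact ⟨z, Prod.ext h2 h1⟩

lemma MatrixGraph.eq_zero_iff [Nontrivial A] [Nontrivial B] (G : MatrixGraph F A B) {x : A × B}
    (hx : x ∈ G.1) : x.1 = 0 ↔ x.2 = 0 := by
  obtain ⟨_, n, hn, φ, ψ, rfl⟩ := G
  obtain ⟨y, rfl⟩ := hx
  change φ y = 0 ↔ ψ y = 0
  rw [map_eq_zero_iff _ (matrix_algHom_injective φ), map_eq_zero_iff _ (matrix_algHom_injective ψ)]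

/-- Countable-dimensional unital locally matrix algebras with the same matrix degrees are
isomorphic. -/
theorem nonempty_algEquiv_of_matrixDegrees_eq
    (hA : IsUnitalLocallyMatrix F A) (hB : IsUnitalLocallyMatrix F B)
    (hdA : Module.rank F A ≤ Cardinal.aleph0) (hdB : Module.rank F B ≤ Cardinal.aleph0)
    (hD : matrixDegrees F A = matrixDegrees F B) : Nonempty (A ≃ₐ[F] B) := by
  have := hA.nontrivial
  have := hB.nontrivial
  let bA := Module.Free.chooseBasis F A
  let bB := Module.Free.chooseBasis F B
  have : Countable (Module.Free.ChooseBasisIndex F A) := by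
    rw [← Cardinal.mk_le_aleph0_iff, ← Module.Free.rank_eq_card_chooseBasisIndex]; exact hdA
  have : Countable (Module.Free.ChooseBasisIndex F B) := by
    rw [← Cardinal.mk_le_aleph0_iff, ← Module.Free.rank_eq_card_chooseBasisIndex]; exact hdB
  let ι := Module.Free.ChooseBasisIndex F A ⊕ Module.Free.ChooseBasisIndex F B
  let : Encodable ι := Encodable.ofCountable ι
  let 𝒟 : ι → Order.Cofinal (MatrixGraph F A B) := fun c =>
    { carrier := {G | Sum.elim (fun a => ∃ b, (a, b) ∈ G.1) (fun b => ∃ a, (a, b) ∈ G.1)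
        (Sum.map bA bB c)}
      isCofinal := fun G =>
        let ⟨G', h1, h2⟩ := MatrixGraph.exists_ge hA hB hD G (Sum.map bA bB c)
        ⟨G', h2, h1⟩ }
  obtain ⟨-, ⟨φ₀⟩⟩ := mem_matrixDegrees_iff.1 hA.one_mem_matrixDegrees
  obtain ⟨-, ⟨ψ₀⟩⟩ := mem_matrixDegrees_iff.1 hB.one_mem_matrixDegrees
  let I := Order.idealOfCofinals ⟨_, 1, inferInstance, φ₀, ψ₀, rfl⟩ 𝒟
  let H : I → Subalgebra F (A × B) := fun G => G.1.1
  have : Nonempty I := I.nonempty.to_subtype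
  have hH : Directed (· ≤ ·) H := fun x y =>
    let ⟨z, hz, h1, h2⟩ := I.directed x.1 x.2 y.1 y.2
    ⟨⟨z, hz⟩, h1, h2⟩
  let G : Subalgebra F (A × B) := ⨆ i, H i
  have hG : ∀ {x}, x ∈ G ↔ ∃ i, x ∈ H i := fun {x} => by
    rw [← SetLike.mem_coe, Subalgebra.coe_iSup_of_directed hH, Set.mem_iUnion]; rfl
  have hmeet (c : ι) := Order.cofinal_meets_idealOfCofinals
    (⟨_, 1, inferInstance, φ₀, ψ₀, rfl⟩ : MatrixGraph F A B) 𝒟 c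
  let πA : G →ₐ[F] A := (AlgHom.fst F A B).comp G.val
  let πB : G →ₐ[F] B := (AlgHom.snd F A B).comp G.val
  have hzero : ∀ x : G, πA x = 0 ↔ πB x = 0 := fun x => by
    obtain ⟨i, hi⟩ := hG.1 x.2
    exact MatrixGraph.eq_zero_iff i.1 hi
  have hinjA : Function.Injective πA := (injective_iff_map_eq_zero πA).2 fun x hx =>
    Subtype.ext (Prod.ext hx ((hzero x).1 hx))
  have hinjB : Function.Injective πB := (injective_iff_map_eq_zero πB).2 fun x hx =>
    Subtype.ext (Prod.ext ((hzero x).2 hx) hx)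
  have hsurjA : Function.Surjective πA := by
    change Function.Surjective πA.toLinearMap
    rw [← LinearMap.range_eq_top, eq_top_iff, ← bA.span_eq, Submodule.span_le]
    rintro _ ⟨i, rfl⟩
    obtain ⟨K, ⟨b, hb⟩, hK⟩ := hmeet (Sum.inl i)
    exact ⟨⟨_, hG.2 ⟨⟨K, hK⟩, hb⟩⟩, rfl⟩
  have hsurjB : Function.Surjective πB := by
    change Function.Surjective πB.toLinearMap
    rw [← LinearMap.range_eq_top, eq_top_iff, ← bB.span_eq, Submodule.span_le]
    rintro _ ⟨i, rfl⟩
    obtain ⟨K, ⟨a, ha⟩, hK⟩ := hmeet (Sum.inr i)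
    exact ⟨⟨_, hG.2 ⟨⟨K, hK⟩, ha⟩⟩, rfl⟩
  exact ⟨(AlgEquiv.ofBijective πA ⟨hinjA, hsurjA⟩).symm.trans
    (AlgEquiv.ofBijective πB ⟨hinjB, hsurjB⟩)⟩

end Isomorphism

section CornerLemmas

variable {F : Type*} [Field F] {A : Type*} [Ring A] [Algebra F A]

lemma Corner.nontrivial {e : A} (he : IsIdempotentElem e) (h : e ≠ 0) :
    Nontrivial (Corner F e he) :=
  ⟨⟨1, 0, fun h' => h (congrArg Subtype.val h')⟩⟩

lemma Corner.rank_le (e : A) (he : IsIdempotentElem e) :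
    Module.rank F (Corner F e he) ≤ Module.rank F A :=
  LinearMap.rank_le_of_injective (cornerSubalgebra F e he).toSubmodule.subtype
    Subtype.val_injective

/-- If the idempotent `p q` of `M_N` is mapped to `e`, with `q p = 1`, then a smaller matrix
algebra maps to the corner of `e`. -/
def cornerAlgHom {N κ : Type*} [Fintype N] [DecidableEq N] [Fintype κ] [DecidableEq κ] {e : A}
    (he : IsIdempotentElem e) (Φ : Matrix N N F →ₐ[F] A) (p : Matrix N κ F) (q : Matrix κ N F)
    (hqp : q * p = 1) (hΦ : Φ (p * q) = e) : Matrix κ κ F →ₐ[F] Corner F e he :=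
  have key : ∀ x : Matrix κ κ F, (p * q) * (p * x * q) * (p * q) = p * x * q := fun x => by
    calc (p * q) * (p * x * q) * (p * q) = p * (q * p) * x * (q * p) * q := by
          simp only [Matrix.mul_assoc]
      _ = p * x * q := by rw [hqp, Matrix.mul_one, Matrix.mul_one]
  AlgHom.ofLinearMap
    { toFun := fun x => ⟨Φ (p * x * q), by
        change e * Φ (p * x * q) * e = Φ (p * x * q)
        rw [← hΦ, ← map_mul, ← map_mul, key]⟩
      map_add' := fun x y => Subtype.ext (by
        simp [Matrix.mul_add, Matrix.add_mul])
      map_smul' := fun c x => Subtype.ext (by simp) }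
    (Subtype.ext (by
      change Φ (p * 1 * q) = e
      rw [Matrix.mul_one, hΦ]))
    (fun x y => Subtype.ext (by
      change Φ _ = Φ _ * Φ _
      rw [← map_mul]
      congr 1
      calc p * (x * y) * q = p * x * (q * p) * y * q := by
            rw [hqp, Matrix.mul_one, ← Matrix.mul_assoc p]
        _ = p * x * q * (p * y * q) := by simp only [Matrix.mul_assoc]))

lemma cornerAlgHom_apply {N κ : Type*} [Fintype N] [DecidableEq N] [Fintype κ] [DecidableEq κ]
    {e : A} (he : IsIdempotentElem e) (Φ : Matrix N N F →ₐ[F] A) (p : Matrix N κ F)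
    (q : Matrix κ N F) (hqp : q * p = 1) (hΦ : Φ (p * q) = e) (x : Matrix κ κ F) :
    (cornerAlgHom he Φ p q hqp hΦ x : A) = Φ (p * x * q) :=
  rfl

lemma mem_range_cornerAlgHom {N κ : Type*} [Fintype N] [DecidableEq N] [Fintype κ] [DecidableEq κ]
    {e : A} (he : IsIdempotentElem e) (Φ : Matrix N N F →ₐ[F] A) (p : Matrix N κ F)
    (q : Matrix κ N F) (hqp : q * p = 1) (hΦ : Φ (p * q) = e) (x : Corner F e he)
    (hx : (x : A) ∈ Set.range Φ) : x ∈ Set.range (cornerAlgHom he Φ p q hqp hΦ) := by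
  obtain ⟨y, hy⟩ := hx
  refine ⟨q * y * p, Subtype.ext ?_⟩
  rw [cornerAlgHom_apply]
  have h1 : p * (q * y * p) * q = (p * q) * y * (p * q) := by simp only [Matrix.mul_assoc]
  rw [h1, map_mul, map_mul, hΦ, hy]
  exact x.2

/-- Finite subsets of the corner of an idempotent of rank `r` in `M_n ⊆ A` lie in matrix
subalgebras `M_s` of the corner which come from some `M_N ⊆ A`, where `n s = r N`. -/
lemma exists_matrix_in_corner (hA : IsUnitalLocallyMatrix F A) {n d r : ℕ} [NeZero n]
    (φ : Matrix (Fin n) (Fin n) F →ₐ[F] A) (ψ : Matrix (Fin d) (Fin d) F →ₐ[F] A)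
    (p : Matrix (Fin n) (Fin r) F) (q : Matrix (Fin r) (Fin n) F)
    (hqp : q * p = 1) {e : A} (he : IsIdempotentElem e) (hφ : φ (p * q) = e)
    (S : Finset (Corner F e he)) :
    ∃ (N s : ℕ) (_ : NeZero N) (Ψ : Matrix (Fin s) (Fin s) F →ₐ[F] Corner F e he),
      N ∈ matrixDegrees F A ∧ Nonempty (Matrix (Fin d) (Fin d) F →ₐ[F] Matrix (Fin N) (Fin N) F) ∧
      n * s = r * N ∧ (S : Set (Corner F e he)) ⊆ Set.range Ψ := by
  classical
  have := hA.nontrivial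
  obtain ⟨N, hN, Φ, ι, hs, hι⟩ := hA.exists_extension
    (S.image (fun x : Corner F e he => (x : A)) ∪
      Finset.univ.image fun ij : Fin d × Fin d => ψ (Matrix.single ij.1 ij.2 1)) φ
  obtain ⟨κ, -⟩ := exists_comp_eq_of_range_subset ψ Φ
    (mem_range_of_single_mem_range ψ Φ fun i j => hs (by
      simp only [Finset.coe_union, Set.mem_union, Finset.mem_coe, Finset.mem_image]
      exact Or.inr ⟨(i, j), Finset.mem_univ _, rfl⟩))
  obtain ⟨t, P, Q, hPQ, hQP, h⟩ := Matrix.exists_algHom_eq_conj_kronecker_one ι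
  have hcard := Matrix.card_eq_of_mul_eq_one hPQ hQP
  simp only [Fintype.card_prod, Fintype.card_fin] at hcard
  let p' := P * (p ⊗ₖ (1 : Matrix (Fin t) (Fin t) F))
  let q' := (q ⊗ₖ (1 : Matrix (Fin t) (Fin t) F)) * Q
  have hqp' : q' * p' = 1 := by
    calc q' * p' = (q ⊗ₖ (1 : Matrix (Fin t) (Fin t) F)) * (Q * P) *
          (p ⊗ₖ (1 : Matrix (Fin t) (Fin t) F)) := by simp only [q', p', Matrix.mul_assoc]
      _ = 1 := by
          rw [hQP, Matrix.mul_one, ← Matrix.mul_kronecker_mul, hqp, Matrix.mul_one,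
            Matrix.one_kronecker_one]
  have hpq' : Φ (p' * q') = e := by
    rw [← hφ, ← hι, h]
    congr 1
    calc p' * q' = P * ((p ⊗ₖ (1 : Matrix (Fin t) (Fin t) F)) *
          (q ⊗ₖ (1 : Matrix (Fin t) (Fin t) F))) * Q := by simp only [q', p', Matrix.mul_assoc]
      _ = _ := by rw [← Matrix.mul_kronecker_mul, Matrix.mul_one]
  let E := Matrix.reindexAlgEquiv F F (finProdFinEquiv : Fin r × Fin t ≃ Fin (r * t))
  refine ⟨N, r * t, hN, (cornerAlgHom he Φ p' q' hqp' hpq').comp E.symm.toAlgHom,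
    mem_matrixDegrees_iff.2 ⟨NeZero.one_le, ⟨Φ⟩⟩, ⟨κ⟩, by rw [hcard]; ring, fun x hx => ?_⟩
  obtain ⟨y, hy⟩ := mem_range_cornerAlgHom he Φ p' q' hqp' hpq' x (hs (by
    simp only [Finset.coe_union, Set.mem_union, Finset.mem_coe, Finset.mem_image]
    exact Or.inl ⟨x, hx, rfl⟩))
  exact ⟨E y, by simpa using hy⟩

lemma isUnitalLocallyMatrix_corner (hA : IsUnitalLocallyMatrix F A) {n r : ℕ} [NeZero n]
    (φ : Matrix (Fin n) (Fin n) F →ₐ[F] A)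
    (p : Matrix (Fin n) (Fin r) F) (q : Matrix (Fin r) (Fin n) F)
    (hqp : q * p = 1) {e : A} (he : IsIdempotentElem e) (hφ : φ (p * q) = e) (hr : 0 < r)
    (he0 : e ≠ 0) : IsUnitalLocallyMatrix F (Corner F e he) := by
  have := Corner.nontrivial (F := F) he he0
  refine isUnitalLocallyMatrix_iff.2 fun S => ?_
  obtain ⟨N, s, hN, Ψ, -, -, hs, hS⟩ := exists_matrix_in_corner hA φ φ p q hqp he hφ S
  refine ⟨s, ⟨?_⟩, Ψ, hS⟩
  rintro rfl
  exact (Nat.mul_pos hr (NeZero.pos N)).ne' (by simpa using hs.symm)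

/-- The Steinitz number of the corner of an idempotent of rank `r` in `M_n ⊆ A` is `r / n` times
that of `A`. -/
lemma dvd_mul_matrixDegrees_corner_iff (hA : IsUnitalLocallyMatrix F A) {n r : ℕ} [NeZero n]
    (φ : Matrix (Fin n) (Fin n) F →ₐ[F] A)
    (p : Matrix (Fin n) (Fin r) F) (q : Matrix (Fin r) (Fin n) F)
    (hqp : q * p = 1) {e : A} (he : IsIdempotentElem e) (hφ : φ (p * q) = e) (hr : 0 < r)
    (he0 : e ≠ 0) (m : ℕ) :
    (∃ d ∈ matrixDegrees F (Corner F e he), m ∣ n * d) ↔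
      ∃ d ∈ matrixDegrees F A, m ∣ r * d := by
  classical
  have := hA.nontrivial
  have := Corner.nontrivial (F := F) he he0
  constructor
  · rintro ⟨d, hd, hm⟩
    obtain ⟨hd1, ⟨χ⟩⟩ := mem_matrixDegrees_iff.1 hd
    have : NeZero d := ⟨by omega⟩
    obtain ⟨N, s, hN, Ψ, hND, -, hs, hS⟩ := exists_matrix_in_corner hA φ φ p q hqp he hφ
      (Finset.univ.image fun ij : Fin d × Fin d => χ (Matrix.single ij.1 ij.2 1))
    have : NeZero s := ⟨by
      rintro rfl
      exact (Nat.mul_pos hr (NeZero.pos N)).ne' (by simpa using hs.symm)⟩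
    obtain ⟨κ, -⟩ := exists_comp_eq_of_range_subset χ Ψ
      (mem_range_of_single_mem_range χ Ψ fun i j => hS (by
        simp only [Finset.mem_coe, Finset.mem_image]
        exact ⟨(i, j), Finset.mem_univ _, rfl⟩))
    exact ⟨N, hND, hm.trans (hs ▸ Nat.mul_dvd_mul_left n (dvd_of_algHom_matrix κ))⟩
  · rintro ⟨d, hd, hm⟩
    obtain ⟨hd1, ⟨ψ⟩⟩ := mem_matrixDegrees_iff.1 hd
    have : NeZero d := ⟨by omega⟩
    obtain ⟨N, s, hN, Ψ, hND, ⟨κ⟩, hs, -⟩ := exists_matrix_in_corner hA φ ψ p q hqp he hφ ∅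
    refine ⟨s, mem_matrixDegrees_iff.2 ⟨Nat.pos_of_ne_zero ?_, ⟨Ψ⟩⟩,
      hm.trans (hs ▸ Nat.mul_dvd_mul_left r (dvd_of_algHom_matrix κ))⟩
    rintro rfl
    exact (Nat.mul_pos hr (NeZero.pos N)).ne' (by simpa using hs.symm)

end CornerLemmas

lemma Matrix.exists_mul_eq_one_of_lt {F : Type*} [Field F] {s d : ℕ} (h : s < d) :
    ∃ (p : Matrix (Fin d) (Fin s) F) (q : Matrix (Fin s) (Fin d) F), q * p = 1 ∧ p * q ≠ 1 := by
  let f := Fin.castLE h.le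
  have hf : Function.Injective f := Fin.castLE_injective h.le
  refine ⟨(1 : Matrix (Fin d) (Fin d) F).submatrix id f,
    (1 : Matrix (Fin d) (Fin d) F).submatrix f id, ?_, fun h1 => ?_⟩
  · rw [← Matrix.submatrix_mul _ _ _ _ _ Function.bijective_id, Matrix.mul_one,
      Matrix.submatrix_one _ hf]
  · have h2 := Matrix.card_eq_of_mul_eq_one h1 (by
      rw [← Matrix.submatrix_mul _ _ _ _ _ Function.bijective_id, Matrix.mul_one,
        Matrix.submatrix_one _ hf])
    simp only [Fintype.card_fin] at h2
    omega

/-- For countable dimensional Morita equivalent unital locally matrix algebras `A₁`, `A₂`: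
`st(A₁)/st(A₂) < 1` (i.e. `k · st(A₁) = l · st(A₂)` for some positive integers `l < k`,
encoded by divisor sets) if and only if `A₁` is isomorphic to a proper corner `e A₂ e`
of `A₂`, where `e` is an idempotent with `e ≠ 0` and `e ≠ 1`. -/
theorem steinitz_ratio_lt_one_iff_isomorphic_to_proper_corner
    (F : Type*) [Field F]
    (A₁ : Type u) (A₂ : Type v) [Ring A₁] [Ring A₂] [Algebra F A₁] [Algebra F A₂]
    (hA₁ : IsUnitalLocallyMatrix F A₁) (hA₂ : IsUnitalLocallyMatrix F A₂)
    (hdim₁ : Module.rank F A₁ ≤ Cardinal.aleph0)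
    (hdim₂ : Module.rank F A₂ ≤ Cardinal.aleph0)
    (hMorita : MoritaEquiv A₁ A₂) :
    (∃ k l : ℕ, 0 < l ∧ l < k ∧
        {m : ℕ | ∃ d ∈ matrixDegrees F A₁, m ∣ k * d} =
          {m : ℕ | ∃ d ∈ matrixDegrees F A₂, m ∣ l * d}) ↔
      (∃ (e : A₂) (he : IsIdempotentElem e), e ≠ 0 ∧ e ≠ 1 ∧
        Nonempty (A₁ ≃ₐ[F] Corner F e he)) := by
  have := hA₁.nontrivial
  have := hA₂.nontrivial
  constructor
  · rintro ⟨k, l, hl, hlk, h⟩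
    have hS : ∀ m, (∃ d ∈ matrixDegrees F A₁, m ∣ k * d) ↔ ∃ d ∈ matrixDegrees F A₂, m ∣ l * d :=
      fun m => Set.ext_iff.1 h m
    have hk : 0 < k := hl.trans hlk
    obtain ⟨d, hd, s, hs⟩ := (hS k).1 ⟨1, hA₁.one_mem_matrixDegrees, by simp⟩
    obtain ⟨hd1, ⟨φ⟩⟩ := mem_matrixDegrees_iff.1 hd
    have : NeZero d := ⟨by omega⟩
    have hs0 : 0 < s := Nat.pos_of_mul_pos_left (hs ▸ Nat.mul_pos hl hd1)
    have hsd : s < d := by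
      by_contra! hds
      have h1 : k * s < k * s := calc
        k * s = l * d := hs.symm
        _ < k * d := Nat.mul_lt_mul_of_pos_right hlk hd1
        _ ≤ k * s := Nat.mul_le_mul_left k hds
      exact h1.false
    obtain ⟨p, q, hqp, hpq⟩ := Matrix.exists_mul_eq_one_of_lt (F := F) hsd
    have hidem : p * q * (p * q) = p * q := by
      rw [Matrix.mul_assoc, ← Matrix.mul_assoc q, hqp, Matrix.one_mul]
    have he : IsIdempotentElem (φ (p * q)) := by rw [IsIdempotentElem, ← map_mul, hidem]
    have hinj := matrix_algHom_injective φ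
    have he1 : φ (p * q) ≠ 1 := fun h1 => hpq (hinj (h1.trans (map_one φ).symm))
    have he0 : φ (p * q) ≠ 0 := fun h0 => by
      have h2 : p * q = 0 := hinj (h0.trans (map_zero φ).symm)
      have h3 : (1 : Matrix (Fin s) (Fin s) F) = 0 := by
        calc (1 : Matrix (Fin s) (Fin s) F) = q * (p * q) * p := by
              rw [← Matrix.mul_assoc, hqp, Matrix.one_mul, hqp]
          _ = 0 := by rw [h2, Matrix.mul_zero, Matrix.zero_mul]
      have : NeZero s := ⟨hs0.ne'⟩
      exact one_ne_zero h3
    have hcorner := dvd_mul_matrixDegrees_corner_iff hA₂ φ p q hqp he rfl hs0 he0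
    have hC := isUnitalLocallyMatrix_corner hA₂ φ p q hqp he rfl hs0 he0
    have := hC.nontrivial
    refine ⟨_, he, he0, he1, nonempty_algEquiv_of_matrixDegrees_eq hA₁ hC hdim₁
      ((Corner.rank_le _ he).trans hdim₂) ?_⟩
    ext x
    constructor
    · intro hx
      obtain ⟨d₂, hd₂, h2⟩ := (hS (k * x)).1 ⟨x, hx, dvd_rfl⟩
      obtain ⟨d₃, hd₃, h3⟩ := (hcorner (d * x)).2 ⟨d₂, hd₂, by
        refine Nat.dvd_of_mul_dvd_mul_left hk ?_
        calc k * (d * x) = d * (k * x) := by ring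
          _ ∣ d * (l * d₂) := Nat.mul_dvd_mul_left d h2
          _ = l * d * d₂ := by ring
          _ = k * (s * d₂) := by rw [hs]; ring⟩
      exact mem_matrixDegrees_of_dvd hd₃ (Nat.dvd_of_mul_dvd_mul_left hd1 h3)
    · intro hx
      obtain ⟨d₂, hd₂, h2⟩ := (hcorner (d * x)).1 ⟨x, hx, dvd_rfl⟩
      obtain ⟨d₁, hd₁, h1⟩ := (hS (k * x)).2 ⟨d₂, hd₂, by
        refine Nat.dvd_of_mul_dvd_mul_left hd1 ?_
        calc d * (k * x) = k * (d * x) := by ring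
          _ ∣ k * (s * d₂) := Nat.mul_dvd_mul_left k h2
          _ = l * d * d₂ := by rw [hs]; ring
          _ = d * (l * d₂) := by ring⟩
      exact mem_matrixDegrees_of_dvd hd₁ (Nat.dvd_of_mul_dvd_mul_left hk h1)
  · rintro ⟨e, he, he0, he1, ⟨f⟩⟩
    obtain ⟨n, hn, φ, hφ⟩ := isUnitalLocallyMatrix_iff.1 hA₂ {e}
    obtain ⟨e₀, rfl⟩ := hφ (by simp : e ∈ _)
    have he₀ : IsIdempotentElem e₀ :=
      matrix_algHom_injective φ (by rw [map_mul]; exact he)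
    obtain ⟨r, p, q, hpq, hqp⟩ :=
      Matrix.exists_rectangular_factorization_of_isIdempotentElem he₀
    have hr : 0 < r := by
      rw [Nat.pos_iff_ne_zero]
      rintro rfl
      refine he0 ?_
      rw [← hpq, Subsingleton.elim p 0, Matrix.zero_mul, map_zero]
    have hrn : r < n := by
      have h1 : r ≤ n := by
        have h2 := Matrix.rank_mul_le_left q p
        rw [hqp, Matrix.rank_one, Fintype.card_fin] at h2
        exact h2.trans (Matrix.rank_le_width q)
      refine lt_of_le_of_ne h1 ?_
      rintro rfl
      exact he1 (by rw [← hpq, mul_eq_one_comm.1 hqp, map_one])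
    refine ⟨n, r, hr, hrn, ?_⟩
    rw [matrixDegrees_congr f]
    exact Set.ext (dvd_mul_matrixDegrees_corner_iff hA₂ φ p q hqp he (by rw [hpq]) hr he0)
end

section
/- Let A be a unital locally matrix algebra over a field F and let e ∈ A be a nonzero idempotent. Then the corner eAe, with multiplication inherited from A and unit e, is a unital locally matrix algebra over F. -/
/-- An idempotent matrix over a field splits as `L * R` with `R * L` an identity matrix. -/
lemma exists_mul_eq_and_mul_eq_one_of_isIdempotentElem {F n : Type*} [Field F] [Fintype n]
    [DecidableEq n] {P : Matrix n n F} (hP : IsIdempotentElem P) :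
    ∃ (r : ℕ) (L : Matrix n (Fin r) F) (R : Matrix (Fin r) n F), L * R = P ∧ R * L = 1 := by
  let f := Matrix.toLin' P
  have hf : f ∘ₗ f = f := by rw [← Matrix.toLin'_mul, hP.eq]
  let b := Module.finBasis F (LinearMap.range f)
  refine ⟨_, LinearMap.toMatrix b (Pi.basisFun F n) (LinearMap.range f).subtype,
    LinearMap.toMatrix (Pi.basisFun F n) b f.rangeRestrict, ?_, ?_⟩
  · rw [← LinearMap.toMatrix_comp, LinearMap.subtype_comp_codRestrict]
    exact LinearMap.toMatrix'_toLin' P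
  · have h : f.rangeRestrict ∘ₗ (LinearMap.range f).subtype = LinearMap.id := by
      ext1 ⟨_, y, rfl⟩
      exact Subtype.ext (LinearMap.congr_fun hf y)
    rw [← LinearMap.toMatrix_comp, h, LinearMap.toMatrix_id]

/-- An algebra map `g` from `n × n` matrices sending `L * R` to `e`, where `R * L = 1`, induces
the unital algebra map `M ↦ g (L * M * R)` from `r × r` matrices to the corner at `e`. -/
def Corner.ofMatrix {F A : Type*} [Field F] [Ring A] [Algebra F A] {n r : Type*} [Fintype n]
    [DecidableEq n] [Fintype r] [DecidableEq r] (g : Matrix n n F →ₐ[F] A) {e : A}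
    (he : IsIdempotentElem e) (L : Matrix n r F) (R : Matrix r n F) (hLR : g (L * R) = e)
    (hRL : R * L = 1) : Matrix r r F →ₐ[F] Corner F e he :=
  have mul_cancel (M N : Matrix r r F) : L * M * R * (L * N * R) = L * (M * N) * R := by
    rw [show L * M * R * (L * N * R) = L * M * (R * L) * N * R by simp only [Matrix.mul_assoc],
      hRL, Matrix.mul_one, Matrix.mul_assoc L M N]
  AlgHom.ofLinearMap
    { toFun := fun M => ⟨g (L * M * R), by
        change e * g (L * M * R) * e = g (L * M * R)
        have h : L * R = L * (1 : Matrix r r F) * R := by rw [Matrix.mul_one]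
        rw [← hLR, ← map_mul, ← map_mul, h, mul_cancel, mul_cancel, Matrix.one_mul,
          Matrix.mul_one]⟩
      map_add' := fun M N => Subtype.ext <| by
        change g _ = g _ + g _
        rw [Matrix.mul_add, Matrix.add_mul, map_add]
      map_smul' := fun c M => Subtype.ext <| by
        change g _ = c • g _
        rw [Matrix.mul_smul, Matrix.smul_mul, map_smul] }
    (Subtype.ext <| by
      change g (L * 1 * R) = e
      rw [Matrix.mul_one, hLR])
    (fun M N => Subtype.ext <| by
      change g _ = g _ * g _
      rw [← map_mul, mul_cancel])

/-- The corner `eAe` of a unital locally matrix algebra at a nonzero idempotent `e`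
(with multiplication inherited from `A` and unit `e`) is a unital locally matrix
algebra over `F`. -/
theorem corner_isUnitalLocallyMatrix (F : Type*) [Field F]
    (A : Type*) [Ring A] [Algebra F A]
    (hA : IsUnitalLocallyMatrix F A)
    (e : A) (he : IsIdempotentElem e) (hne : e ≠ 0) :
    IsUnitalLocallyMatrix F (Corner F e he) := by
  classical
  intro s
  obtain ⟨n, B, -, hsB, ⟨φ⟩⟩ := hA (insert e (s.image Subtype.val))
  have heB : e ∈ B := hsB (by simp)
  let g : Matrix (Fin n) (Fin n) F →ₐ[F] A := B.val.comp φ.symm.toAlgHom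
  have hg (x : A) (hx : x ∈ B) : g (φ ⟨x, hx⟩) = x := by simp [g]
  have hg_inj : Function.Injective g := Subtype.val_injective.comp φ.symm.injective
  have hP : IsIdempotentElem (φ ⟨e, heB⟩) := hg_inj (by rw [map_mul, hg, he.eq])
  obtain ⟨r, L, R, hLR, hRL⟩ := exists_mul_eq_and_mul_eq_one_of_isIdempotentElem hP
  have hge : g (L * R) = e := by rw [hLR, hg]
  let ψ := Corner.ofMatrix g he L R hge hRL
  have hψ_inj : Function.Injective ψ := by
    intro M N hMN
    have hg_eq : g (L * M * R) = g (L * N * R) :=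
      congrArg (fun x : Corner F e he => (x : A)) hMN
    have h : L * M * R = L * N * R := hg_inj hg_eq
    have hcancel (M : Matrix (Fin r) (Fin r) F) : R * (L * M * R) * L = M := by
      rw [show R * (L * M * R) * L = R * L * M * (R * L) by simp only [Matrix.mul_assoc],
        hRL, Matrix.one_mul, Matrix.mul_one]
    rw [← hcancel M, h, hcancel]
  refine ⟨r, ψ.range, ?_, ?_, ⟨(AlgEquiv.ofInjective ψ hψ_inj).symm⟩⟩
  · refine Nat.one_le_iff_ne_zero.mpr fun hr => hne ?_
    subst hr
    have hzero : L * R = 0 := by ext; simp [Matrix.mul_apply]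
    rw [← hge, hzero, map_zero]
  · intro x hx
    have hxB : (x : A) ∈ B := hsB (by simpa using Or.inr hx)
    refine ⟨R * φ ⟨x, hxB⟩ * L, Subtype.ext ?_⟩
    change g (L * (R * φ ⟨x, hxB⟩ * L) * R) = x
    rw [show L * (R * φ ⟨x, hxB⟩ * L) * R = L * R * φ ⟨x, hxB⟩ * (L * R) by
      simp only [Matrix.mul_assoc], map_mul, map_mul, hge, hg]
    exact x.2
end
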